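/- Let p ≥ 3 be an integer and let v be a simple L-periodic arc-length curve of class C⁴ which is strictly convex, i.e. k(s) > 0 for all s. Let (N₀, (s^j)_{j≥0}, (d^j)_{j≥1}) be data of the (S_p, S_{p−2}) normal multiscale transform for v with N₀ ≥ ⌈p/2⌉ + 1, which are convergent, and assume that s^{j−1}_i ≤ s^j_K ≤ s^{j−1}_{i+p+1} whenever j ≥ 1, i ∈ ℤ and 2i ≤ K ≤ 2i + p + 2. Let T be a subdivision operator given by a finitely supported mask b : ℤ → ℝ via (Tx)_i = Σ_{k∈ℤ} b_{i−2k} x_k (acting componentwise on ℝ²-valued sequences), which exactly reproduces polynomials of degree ≤ 3 with shift (p−1)/4, i.e. for every polynomial 𝔭 with deg 𝔭 ≤ 3 and every i ∈ ℤ, (T(𝔭|_ℤ))_i = 𝔭(i/2 + (p−1)/4). Define the combined details d̃^j_K := (v(s^j_K) − (T(v∘s^{j−1}))_K) · (w^j_K)^⊥/|w^j_K|. Then there exists a constant C such that sup_{K∈ℤ} |d̃^j_K| ≤ C·2^{−4j} for all j ≥ 1 (the (S_p, S_{p−2}, T) normal multiscale transform has detail decay rate 4). -/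

import Mathlib

/-- The Lane–Riesenfeld (B-spline) subdivision operator `S p`, acting on sequences with
values in a real vector space (componentwise averaging). -/
noncomputable def S {E : Type*} [AddCommGroup E] [Module ℝ E] : ℕ → (ℤ → E) → ℤ → E
  | 0, x, i => x (Int.fdiv i 2)
  | p + 1, x, i => (2⁻¹ : ℝ) • (S p x i + S p x (i + 1))

/-- Forward difference operator. -/
def Δ {E : Type*} [AddCommGroup E] (x : ℤ → E) : ℤ → E := fun i => x (i + 1) - x i

/-- Euclidean scalar product on `ℝ²`. -/
noncomputable def dot (u w : ℝ × ℝ) : ℝ := u.1 * w.1 + u.2 * w.2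

/-- Euclidean norm on `ℝ²`. -/
noncomputable def enorm2 (u : ℝ × ℝ) : ℝ := Real.sqrt (u.1 ^ 2 + u.2 ^ 2)

/-- Rotation by 90°: `u^⊥ = (−u₂, u₁)`. -/
def perp (u : ℝ × ℝ) : ℝ × ℝ := (-u.2, u.1)

/-- Signed curvature `k(s) = v''(s)·(v'(s))^⊥` of an arc-length parametrized curve. -/
noncomputable def curv (v : ℝ → ℝ × ℝ) (s : ℝ) : ℝ :=
  dot (deriv (deriv v) s) (perp (deriv v s))

/-- The continuous piecewise-linear interpolant of the data `x : ℤ → ℝ` on the grid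
`2^{−j}ℤ`. -/
noncomputable def plin (j : ℕ) (x : ℤ → ℝ) (t : ℝ) : ℝ :=
  x ⌊(2 : ℝ) ^ j * t⌋ +
    ((2 : ℝ) ^ j * t - (⌊(2 : ℝ) ^ j * t⌋ : ℤ)) * (x (⌊(2 : ℝ) ^ j * t⌋ + 1) - x ⌊(2 : ℝ) ^ j * t⌋)

section Subdivision

variable {p : ℕ} {K : ℤ} {x y z : ℤ → ℝ}

theorem S_succ (p : ℕ) (x : ℤ → ℝ) (K : ℤ) :
    S (p + 1) x K = 2⁻¹ * (S p x K + S p x (K + 1)) := rfl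

theorem S_fst (p : ℕ) (x : ℤ → ℝ × ℝ) (K : ℤ) :
    (S p x K).1 = S p (fun i => (x i).1) K := by
  induction p generalizing K with
  | zero => rfl
  | succ p ih => simp [S, ih, mul_add]

theorem S_snd (p : ℕ) (x : ℤ → ℝ × ℝ) (K : ℤ) :
    (S p x K).2 = S p (fun i => (x i).2) K := by
  induction p generalizing K with
  | zero => rfl
  | succ p ih => simp [S, ih, mul_add]

theorem S_add (p : ℕ) (x y : ℤ → ℝ) (K : ℤ) :
    S p (fun i => x i + y i) K = S p x K + S p y K := by
  induction p generalizing K with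
  | zero => rfl
  | succ p ih => simp only [S, ih, smul_eq_mul]; ring

theorem S_const_mul (p : ℕ) (c : ℝ) (x : ℤ → ℝ) (K : ℤ) :
    S p (fun i => c * x i) K = c * S p x K := by
  induction p generalizing K with
  | zero => rfl
  | succ p ih => simp only [S, ih, smul_eq_mul]; ring

theorem S_sub (p : ℕ) (x y : ℤ → ℝ) (K : ℤ) :
    S p (fun i => x i - y i) K = S p x K - S p y K := by
  induction p generalizing K with
  | zero => rfl
  | succ p ih => simp only [S, ih, smul_eq_mul]; ring

theorem S_const (p : ℕ) (c : ℝ) (K : ℤ) : S p (fun _ => c) K = c := by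
  induction p generalizing K with
  | zero => rfl
  | succ p ih => simp only [S, ih, smul_eq_mul]; ring

theorem S_shift (p : ℕ) (x : ℤ → ℝ) (K : ℤ) :
    S p x (K + 2) = S p (fun i => x (i + 1)) K := by
  induction p generalizing K with
  | zero =>
    simp only [S]
    congr 1
    rw [Int.fdiv_eq_ediv_of_nonneg _ (by norm_num), Int.fdiv_eq_ediv_of_nonneg _ (by norm_num)]
    omega
  | succ p ih =>
    simp only [S, ← ih]
    ring_nf

theorem S_succ_diff (p : ℕ) (x : ℤ → ℝ) (K : ℤ) :
    S (p + 1) x (K + 1) - S (p + 1) x K = 2⁻¹ * S p (fun i => x (i + 1) - x i) K := by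
  rw [S_sub, ← S_shift]
  simp only [S, smul_eq_mul]
  rw [show K + 1 + 1 = K + 2 by ring]
  ring

/-- `S p x K` depends only on the `x i` with `K - 1 ≤ 2 i ≤ K + p`, monotonically. -/
theorem S_mono (h : ∀ i : ℤ, K - 1 ≤ 2 * i → 2 * i ≤ K + p → x i ≤ y i) :
    S p x K ≤ S p y K := by
  induction p generalizing K with
  | zero =>
    simp only [S]
    rw [Int.fdiv_eq_ediv_of_nonneg _ (by norm_num)]
    apply h <;> push_cast <;> omega
  | succ p ih =>
    have h1 := ih (K := K) fun i h1 h2 => h i h1 (by push_cast; omega)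
    have h2 := ih (K := K + 1) fun i h1 h2 => h i (by omega) (by push_cast; omega)
    simp only [S, smul_eq_mul]
    linarith

theorem S_abs_le (h : ∀ i : ℤ, K - 1 ≤ 2 * i → 2 * i ≤ K + p → |x i| ≤ z i) :
    |S p x K| ≤ S p z K := by
  rw [abs_le]
  constructor
  · have := S_mono (p := p) (K := K) (x := fun i => (-1) * z i) (y := x)
      fun i h1 h2 => by linarith [neg_le_of_abs_le (h i h1 h2)]
    rw [S_const_mul] at this
    linarith
  · exact S_mono fun i h1 h2 => le_of_abs_le (h i h1 h2)

theorem S_abs_le_const {M : ℝ} (h : ∀ i : ℤ, K - 1 ≤ 2 * i → 2 * i ≤ K + p → |x i| ≤ M) :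
    |S p x K| ≤ M := by
  simpa only [S_const] using S_abs_le (z := fun _ => M) h

theorem S_pos (h : ∀ i, 0 < x i) : 0 < S p x K := by
  induction p generalizing K with
  | zero => exact h _
  | succ p ih =>
    have h1 := ih (K := K)
    have h2 := ih (K := K + 1)
    simp only [S, smul_eq_mul]
    positivity

/-- The parameter at which `S p` reproduces affine sequences. -/
noncomputable def center (p : ℕ) (K : ℤ) : ℝ := K / 2 + ((p : ℝ) - 1) / 4

theorem S_sub_center (p : ℕ) (K : ℤ) :
    S (p + 1) (fun i => (i : ℝ) - center (p + 1) K) K = 0 := by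
  induction p generalizing K with
  | zero =>
    simp only [S, center, smul_eq_mul]
    rw [Int.fdiv_eq_ediv_of_nonneg _ (by norm_num), Int.fdiv_eq_ediv_of_nonneg _ (by norm_num)]
    rcases Int.even_or_odd' K with ⟨m, rfl | rfl⟩
    · rw [show 2 * m / 2 = m by omega, show (2 * m + 1) / 2 = m by omega]
      push_cast
      ring
    · rw [show (2 * m + 1) / 2 = m by omega, show (2 * m + 1 + 1) / 2 = m + 1 by omega]
      push_cast
      ring
  | succ p ih =>
    have h1 := ih K
    have h2 := ih (K + 1)
    rw [S_sub, S_const] at h1 h2 ⊢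
    rw [S, smul_eq_mul]
    simp only [center] at h1 h2 ⊢
    push_cast at h1 h2 ⊢
    linarith

theorem S_expand (p : ℕ) (c e : ℝ) (K : ℤ) :
    S p (fun i => ((i : ℝ) - (c + e)) ^ 2) K =
      S p (fun i => ((i : ℝ) - c) ^ 2) K - 2 * e * S p (fun i => (i : ℝ) - c) K + e ^ 2 ∧
    S p (fun i => ((i : ℝ) - (c + e)) ^ 3) K =
      S p (fun i => ((i : ℝ) - c) ^ 3) K - 3 * e * S p (fun i => ((i : ℝ) - c) ^ 2) K
        + 3 * e ^ 2 * S p (fun i => (i : ℝ) - c) K - e ^ 3 := by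
  constructor
  · rw [← S_const_mul, ← S_sub]
    conv_rhs => rw [← S_const p (e ^ 2) K, ← S_add]
    congr 1; ext i; ring
  · rw [← S_const_mul, ← S_const_mul, ← S_sub, ← S_add]
    conv_rhs => rw [← S_const p (e ^ 3) K, ← S_sub]
    congr 1; ext i; ring

theorem S_center_moments (p : ℕ) (K : ℤ) :
    S (p + 3) (fun i => ((i : ℝ) - center (p + 3) K) ^ 2) K = ((p : ℝ) + 4) / 16 ∧
    S (p + 3) (fun i => ((i : ℝ) - center (p + 3) K) ^ 3) K = 0 := by
  induction p generalizing K with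
  | zero =>
    simp only [S, center, smul_eq_mul]
    simp only [Int.fdiv_eq_ediv_of_nonneg _ (show (0 : ℤ) ≤ 2 by norm_num)]
    rcases Int.even_or_odd' K with ⟨m, rfl | rfl⟩
    · rw [show 2 * m / 2 = m by omega, show (2 * m + 1) / 2 = m by omega,
        show (2 * m + 1 + 1) / 2 = m + 1 by omega, show (2 * m + 1 + 1 + 1) / 2 = m + 1 by omega]
      push_cast
      constructor <;> ring
    · rw [show (2 * m + 1) / 2 = m by omega,
        show (2 * m + 1 + 1) / 2 = m + 1 by omega, show (2 * m + 1 + 1 + 1) / 2 = m + 1 by omega,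
        show (2 * m + 1 + 1 + 1 + 1) / 2 = m + 2 by omega]
      push_cast
      constructor <;> ring
  | succ p ih =>
    obtain ⟨h1, h2⟩ := ih K
    obtain ⟨h3, h4⟩ := ih (K + 1)
    have h5 := S_sub_center (p + 2) K
    have h6 := S_sub_center (p + 2) (K + 1)
    have e1 : center (p + 1 + 3) K = center (p + 3) K + 1 / 4 := by
      simp only [center]; push_cast; ring
    have e2 : center (p + 1 + 3) K = center (p + 3) (K + 1) + (-1 / 4) := by
      simp only [center]; push_cast; ring
    obtain ⟨a1, a2⟩ := S_expand (p + 3) (center (p + 3) K) (1 / 4) K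
    obtain ⟨b1, b2⟩ := S_expand (p + 3) (center (p + 3) (K + 1)) (-1 / 4) (K + 1)
    rw [← e1] at a1 a2
    rw [← e2] at b1 b2
    simp only [show p + 2 + 1 = p + 3 from rfl] at h5 h6
    rw [h1, h5] at a1
    rw [h1, h2, h5] at a2
    rw [h3, h6] at b1
    rw [h3, h4, h6] at b2
    rw [show p + 1 + 3 = (p + 3) + 1 from rfl] at a1 a2 b1 b2 ⊢
    rw [S_succ (p + 3), S_succ (p + 3), a1, a2, b1, b2]
    push_cast
    constructor <;> ring

end Subdivision

section Newton

theorem abs_sub_le_of_step {z : ℤ → ℝ} {i₀ : ℤ} {N : ℕ} {M : ℝ}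
    (h : ∀ i, |i - i₀| ≤ N → |z (i + 1) - z i| ≤ M) (i : ℤ) (hi : |i - i₀| ≤ N) :
    |z i - z i₀| ≤ N * M := by
  have hM : 0 ≤ M := (abs_nonneg _).trans (h i₀ (by simp))
  have up : ∀ n : ℕ, n ≤ N → |z (i₀ + n) - z i₀| ≤ n * M := by
    intro n
    induction n with
    | zero => simp
    | succ n ih =>
      intro hn
      have h1 := ih (by omega)
      have h2 := h (i₀ + n) (by rw [abs_le]; constructor <;> omega)
      push_cast
      rw [← add_assoc]
      calc _ = |(z (i₀ + n + 1) - z (i₀ + n)) + (z (i₀ + n) - z i₀)| := by ring_nf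
        _ ≤ _ := abs_add_le _ _
        _ ≤ _ := by linarith
  have dn : ∀ n : ℕ, n ≤ N → |z (i₀ - n) - z i₀| ≤ n * M := by
    intro n
    induction n with
    | zero => simp
    | succ n ih =>
      intro hn
      have h1 := ih (by omega)
      have h2 := h (i₀ - n - 1) (by rw [abs_le]; constructor <;> omega)
      rw [sub_add_cancel, abs_sub_comm] at h2
      push_cast
      rw [← sub_sub]
      calc _ = |(z (i₀ - n - 1) - z (i₀ - n)) + (z (i₀ - n) - z i₀)| := by ring_nf
        _ ≤ _ := abs_add_le _ _
        _ ≤ _ := by linarith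
  rw [abs_le] at hi
  rcases le_total i₀ i with hc | hc
  · obtain ⟨n, hn⟩ := Int.eq_ofNat_of_zero_le (sub_nonneg.2 hc)
    have := up n (by omega)
    rw [show i₀ + (n : ℤ) = i by omega] at this
    refine this.trans (mul_le_mul_of_nonneg_right ?_ hM)
    exact_mod_cast (by omega : n ≤ N)
  · obtain ⟨n, hn⟩ := Int.eq_ofNat_of_zero_le (sub_nonneg.2 hc)
    have := dn n (by omega)
    rw [show i₀ - (n : ℤ) = i by omega] at this
    refine this.trans (mul_le_mul_of_nonneg_right ?_ hM)
    exact_mod_cast (by omega : n ≤ N)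

theorem abs_sub_affine_le {y : ℤ → ℝ} {i₀ : ℤ} {N : ℕ} {M : ℝ}
    (h : ∀ i, |y (i + 2) - 2 * y (i + 1) + y i| ≤ M) (i : ℤ) (hi : |i - i₀| ≤ N) :
    |y i - (y i₀ + (i - i₀) * (y (i₀ + 1) - y i₀))| ≤ N ^ 2 * M := by
  have h1 : ∀ i : ℤ, |i - i₀| ≤ N → |y (i + 1) - y i - (y (i₀ + 1) - y i₀)| ≤ N * M := by
    refine abs_sub_le_of_step (z := fun i => y (i + 1) - y i) fun i _ => ?_
    convert h i using 2
    rw [add_assoc]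
    norm_num
    ring
  have := abs_sub_le_of_step (z := fun i => y i - (y i₀ + (i - i₀) * (y (i₀ + 1) - y i₀)))
    (i₀ := i₀) (N := N) (M := N * M) (fun i hi => ?_) i hi
  · simpa [pow_two, mul_assoc] using this
  · convert h1 i hi using 2
    push_cast
    ring

theorem abs_sub_quadratic_le {y : ℤ → ℝ} {i₀ : ℤ} {N : ℕ} {M : ℝ}
    (h : ∀ i, |y (i + 3) - 3 * y (i + 2) + 3 * y (i + 1) - y i| ≤ M) (i : ℤ)
    (hi : |i - i₀| ≤ N) :
    |y i - (y i₀ + (i - i₀) * (y (i₀ + 1) - y i₀) +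
      (i - i₀) * (i - i₀ - 1) / 2 * (y (i₀ + 2) - 2 * y (i₀ + 1) + y i₀))| ≤ N ^ 3 * M := by
  have h1 := fun i hi => abs_sub_affine_le (y := fun i => y (i + 1) - y i) (i₀ := i₀) (N := N)
    (M := M) (fun i => by
      convert h i using 2
      simp only [add_assoc]
      norm_num
      ring) i hi
  have := abs_sub_le_of_step (z := fun i => y i - (y i₀ + (i - i₀) * (y (i₀ + 1) - y i₀) +
      (i - i₀) * (i - i₀ - 1) / 2 * (y (i₀ + 2) - 2 * y (i₀ + 1) + y i₀)))
    (i₀ := i₀) (N := N) (M := N ^ 2 * M) (fun i hi => ?_) i hi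
  · simp only [sub_self, zero_mul, zero_div, add_zero, sub_zero] at this
    rw [pow_succ', mul_assoc]
    exact this
  · convert h1 i hi using 2
    push_cast
    simp only [add_assoc]
    norm_num
    ring

end Newton

section Recurrence

/-- A recursion with contraction factor `θ` and a perturbation decaying like `(θ/2)^j`
propagates decay at rate `θ`. -/
theorem decay_of_recurrence {y : ℕ → ℤ → ℝ} {θ C₀ C : ℝ} (hθ : 0 < θ)
    (h₀ : ∀ i, |y 0 i| ≤ C₀)
    (hstep : ∀ j M, (∀ i, |y j i| ≤ M) → ∀ i, |y (j + 1) i| ≤ θ * M + C * θ ^ j * (1 / 2) ^ j) :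
    ∃ C', ∀ j i, |y j i| ≤ C' * θ ^ j := by
  have key : ∀ j, ∀ i, |y j i| ≤ (C₀ + 2 * C / θ * (1 - (1 / 2) ^ j)) * θ ^ j := by
    intro j
    induction j with
    | zero => simpa using h₀
    | succ j ih =>
      intro i
      refine (hstep j _ ih i).trans (le_of_eq ?_)
      field_simp
      ring
  refine ⟨C₀ + 2 * |C| / θ, fun j i => (key j i).trans ?_⟩
  have h1 : 0 ≤ (1 / 2 : ℝ) ^ j := by positivity
  have h2 : (1 / 2 : ℝ) ^ j ≤ 1 := pow_le_one₀ (by norm_num) (by norm_num)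
  refine mul_le_mul_of_nonneg_right ?_ (by positivity)
  have h3 : 2 * C / θ * (1 - (1 / 2) ^ j) ≤ 2 * |C| / θ * 1 := by
    refine mul_le_mul ?_ (by linarith) (by linarith) (by positivity)
    gcongr
    exact le_abs_self C
  linarith

theorem decay_of_eventually {y : ℕ → ℤ → ℝ} {M C : ℝ} {m J : ℕ}
    (hM : ∀ j i, |y j i| ≤ M) (hC : ∀ j, J ≤ j → ∀ i, |y j i| ≤ C * (1 / 2) ^ (m * j)) :
    ∃ C', 0 ≤ C' ∧ ∀ j i, |y j i| ≤ C' * (1 / 2) ^ (m * j) := by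
  have hM0 : 0 ≤ M := (abs_nonneg _).trans (hM 0 0)
  refine ⟨max |C| (M * 2 ^ (m * J)), by positivity, fun j i => ?_⟩
  rcases le_total J j with h | h
  · refine (hC j h i).trans ?_
    gcongr
    exact (le_abs_self C).trans (le_max_left _ _)
  · refine (hM j i).trans ?_
    calc M = M * 2 ^ (m * J) * (1 / 2) ^ (m * J) := by
          rw [mul_assoc, ← mul_pow]; norm_num
      _ ≤ M * 2 ^ (m * J) * (1 / 2) ^ (m * j) := by
          refine mul_le_mul_of_nonneg_left ?_ (by positivity)
          exact pow_le_pow_of_le_one (by norm_num) (by norm_num) (Nat.mul_le_mul_left _ h)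
      _ ≤ _ := by
        gcongr
        exact le_max_right _ _

/-- A small sequence that is halved up to a cubic perturbation decays like `2^{-n}`. -/
theorem geometric_of_cubic_perturbation {y : ℕ → ℤ → ℝ} {A C : ℝ} (hA : 0 ≤ A)
    (hC : 0 ≤ C) (hAC : 32 * C * A ^ 2 ≤ 1)
    (h₀ : ∀ i, y 0 i ≤ A)
    (hstep : ∀ j M, 0 ≤ M → M ≤ 2 * A → (∀ i, y j i ≤ M) →
      ∀ i, y (j + 1) i ≤ 2⁻¹ * M + C * M ^ 3) (j : ℕ) (i : ℤ) :
    y j i ≤ A * (1 / 2) ^ j * (2 - (1 / 2) ^ j) := by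
  induction j generalizing i with
  | zero => have := h₀ i; norm_num; exact this
  | succ j ih =>
    have t0 : (0 : ℝ) < (1 / 2) ^ j := by positivity
    have t1 : (1 / 2 : ℝ) ^ j ≤ 1 := pow_le_one₀ (by norm_num) (by norm_num)
    rw [pow_succ]
    generalize (1 / 2 : ℝ) ^ j = t at *
    have hu : 0 ≤ t * (2 - t) := by nlinarith
    have hu2 : t * (2 - t) ≤ 2 := by nlinarith
    refine (hstep j _ (by rw [mul_assoc]; positivity) (by nlinarith) ih i).trans ?_
    have e1 : (A * t * (2 - t)) ^ 3 ≤ A ^ 3 * (t * (t * 8)) := by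
      have : (A * t * (2 - t)) ^ 3 = A ^ 3 * (t * (t * (t * (2 - t) ^ 3))) := by ring
      rw [this]
      have e2 : (2 - t) ^ 3 ≤ 2 ^ 3 := pow_le_pow_left₀ (by linarith) (by linarith) 3
      have e3 : t * (2 - t) ^ 3 ≤ 1 * 8 :=
        mul_le_mul t1 (by linarith) (pow_nonneg (by linarith) 3) (by norm_num)
      gcongr
      linarith
    have e4 : C * (A * t * (2 - t)) ^ 3 ≤ C * (A ^ 3 * (t * (t * 8))) := by gcongr
    have e5 : C * (A ^ 3 * (t * (t * 8))) = (32 * C * A ^ 2) * (A * (t * t) / 4) := by ring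
    have e6 : (32 * C * A ^ 2) * (A * (t * t) / 4) ≤ 1 * (A * (t * t) / 4) := by
      gcongr
    nlinarith

end Recurrence

section PiecewiseLinear

theorem plin_eq_of_mem {J : ℕ} {x : ℤ → ℝ} {t : ℝ} {m : ℤ}
    (h1 : (m : ℝ) ≤ 2 ^ J * t) (h2 : 2 ^ J * t ≤ m + 1) :
    plin J x t = x m + (2 ^ J * t - m) * (x (m + 1) - x m) := by
  unfold plin
  rcases h2.lt_or_eq with h | h
  · rw [Int.floor_eq_iff.2 ⟨h1, h⟩]
  · have : (2 : ℝ) ^ J * t = ((m + 1 : ℤ) : ℝ) := by rw [h]; push_cast; ring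
    rw [this, Int.floor_intCast]
    push_cast
    ring

theorem plin_node (j : ℕ) (x : ℤ → ℝ) (i : ℤ) : plin j x (i / 2 ^ j) = x i := by
  have : (2 : ℝ) ^ j * (i / 2 ^ j) = i := by field_simp
  rw [plin_eq_of_mem (m := i) (by rw [this]) (by rw [this]; linarith), this]
  ring

theorem plin_step_le {J j : ℕ} (hJ : J ≤ j) {x : ℤ → ℝ} {M : ℝ}
    (hx : ∀ i, |x (i + 1) - x i| ≤ M) (i : ℤ) :
    |plin J x ((i + 1 : ℤ) / 2 ^ j) - plin J x (i / 2 ^ j)| ≤ M * (1 / 2) ^ (j - J) := by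
  obtain ⟨n, rfl⟩ := Nat.exists_eq_add_of_le hJ
  have e : ∀ a : ℤ, (2 : ℝ) ^ J * (a / 2 ^ (J + n)) = a / 2 ^ n := fun a => by
    rw [pow_add]; field_simp
  have hn : (0 : ℤ) < 2 ^ n := by positivity
  have hn' : (0 : ℝ) < 2 ^ n := by positivity
  have d1 : i / 2 ^ n * 2 ^ n ≤ i := Int.ediv_mul_le _ hn.ne'
  have d2 : i + 1 ≤ (i / 2 ^ n + 1) * 2 ^ n := Int.lt_ediv_add_one_mul_self _ hn
  have d1' : ((i / 2 ^ n : ℤ) : ℝ) * 2 ^ n ≤ i := by exact_mod_cast d1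
  have d2' : (i : ℝ) + 1 ≤ (((i / 2 ^ n : ℤ) : ℝ) + 1) * 2 ^ n := by exact_mod_cast d2
  generalize i / 2 ^ n = m at *
  rw [plin_eq_of_mem (m := m), plin_eq_of_mem (m := m), e, e, Nat.add_sub_cancel_left]
  · have : x m + (((i + 1 : ℤ) : ℝ) / 2 ^ n - m) * (x (m + 1) - x m) -
        (x m + ((i : ℝ) / 2 ^ n - m) * (x (m + 1) - x m)) =
        (x (m + 1) - x m) * (1 / 2) ^ n := by
      push_cast
      rw [one_div, inv_pow]
      field_simp
      ring
    rw [this, abs_mul, abs_of_pos (by positivity : (0 : ℝ) < (1 / 2) ^ n)]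
    gcongr
    exact hx m
  · rw [e, le_div_iff₀ hn']; exact d1'
  · rw [e, div_le_iff₀ hn']; linarith
  · rw [e, le_div_iff₀ hn']; push_cast; linarith
  · rw [e, div_le_iff₀ hn']; push_cast; linarith

end PiecewiseLinear

section Taylor

theorem abs_sub_le_of_hasDerivAt {g g' : ℝ → ℝ} {σ R M x y : ℝ}
    (hg : ∀ t, HasDerivAt g (g' t) t) (hM : ∀ t, |t - σ| ≤ R → |g' t| ≤ M)
    (hx : |x - σ| ≤ R) (hy : |y - σ| ≤ R) : |g x - g y| ≤ M * |x - y| := by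
  have mem : ∀ t, t ∈ Metric.closedBall σ R ↔ |t - σ| ≤ R := fun t => by
    rw [Metric.mem_closedBall, Real.dist_eq]
  exact Convex.norm_image_sub_le_of_norm_hasDerivWithin_le (s := Metric.closedBall σ R)
    (fun t _ => (hg t).hasDerivWithinAt) (fun t ht => hM t ((mem t).1 ht))
    (convex_closedBall σ R) ((mem y).2 hy) ((mem x).2 hx)

theorem abs_le_of_hasDerivAt_pow {g g' : ℝ → ℝ} {σ B : ℝ} {n : ℕ} (hB : 0 ≤ B)
    (hg : ∀ t, HasDerivAt g (g' t) t) (h₀ : g σ = 0)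
    (hM : ∀ t, |g' t| ≤ B * |t - σ| ^ n) (x : ℝ) : |g x| ≤ B * |x - σ| ^ (n + 1) := by
  have := abs_sub_le_of_hasDerivAt (x := x) (y := σ) (R := |x - σ|) (M := B * |x - σ| ^ n) hg
    (fun t ht => (hM t).trans (by gcongr)) le_rfl (by simp)
  rwa [h₀, sub_zero, mul_assoc, ← pow_succ] at this

variable {f f₁ f₂ f₃ f₄ : ℝ → ℝ} {B : ℝ}

theorem taylor_one (hB : 0 ≤ B) (h1 : ∀ t, HasDerivAt f (f₁ t) t)
    (h2 : ∀ t, HasDerivAt f₁ (f₂ t) t) (b : ∀ t, |f₂ t| ≤ B) (σ x : ℝ) :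
    |f x - (f σ + f₁ σ * (x - σ))| ≤ B * |x - σ| ^ 2 := by
  refine abs_le_of_hasDerivAt_pow (g := fun x => f x - (f σ + f₁ σ * (x - σ)))
    (g' := fun x => f₁ x - f₁ σ) (n := 1) hB (fun t => ?_) (by ring) (fun t => ?_) x
  · exact ((h1 t).sub ((((hasDerivAt_id t).sub_const σ).const_mul (f₁ σ)).const_add (f σ))).congr_deriv
      (by ring)
  · refine abs_le_of_hasDerivAt_pow (g := fun t => f₁ t - f₁ σ) (g' := f₂) (n := 0) hB
      (fun t => (h2 t).sub_const _) (by ring) (fun t => by simpa using b t) t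

theorem taylor_three (hB : 0 ≤ B) (h1 : ∀ t, HasDerivAt f (f₁ t) t)
    (h2 : ∀ t, HasDerivAt f₁ (f₂ t) t) (h3 : ∀ t, HasDerivAt f₂ (f₃ t) t)
    (h4 : ∀ t, HasDerivAt f₃ (f₄ t) t) (b : ∀ t, |f₄ t| ≤ B) (σ x : ℝ) :
    |f x - (f σ + f₁ σ * (x - σ) + f₂ σ / 2 * (x - σ) ^ 2 + f₃ σ / 6 * (x - σ) ^ 3)| ≤
      B * |x - σ| ^ 4 := by
  have d1 : ∀ t, HasDerivAt (fun x => x - σ) 1 t := fun t => (hasDerivAt_id t).sub_const σ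
  refine abs_le_of_hasDerivAt_pow (g := fun x => f x -
      (f σ + f₁ σ * (x - σ) + f₂ σ / 2 * (x - σ) ^ 2 + f₃ σ / 6 * (x - σ) ^ 3))
    (g' := fun x => f₁ x - (f₁ σ + f₂ σ * (x - σ) + f₃ σ / 2 * (x - σ) ^ 2)) (n := 3) hB
    (fun t => ?_) (by ring) (fun t => ?_) x
  · exact ((h1 t).sub (((((d1 t).const_mul (f₁ σ)).const_add (f σ)).add
      (((d1 t).pow 2).const_mul (f₂ σ / 2))).add (((d1 t).pow 3).const_mul (f₃ σ / 6)))).congr_deriv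
      (by norm_num; ring)
  refine abs_le_of_hasDerivAt_pow (g := fun x => f₁ x -
      (f₁ σ + f₂ σ * (x - σ) + f₃ σ / 2 * (x - σ) ^ 2))
    (g' := fun x => f₂ x - (f₂ σ + f₃ σ * (x - σ))) (n := 2) hB
    (fun t => ?_) (by ring) (fun t => ?_) t
  · exact ((h2 t).sub ((((d1 t).const_mul (f₂ σ)).const_add (f₁ σ)).add
      (((d1 t).pow 2).const_mul (f₃ σ / 2)))).congr_deriv
      (by norm_num; ring)
  exact taylor_one hB h3 h4 b σ t

theorem taylor_two_diff (hB : 0 ≤ B) (h1 : ∀ t, HasDerivAt f (f₁ t) t)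
    (h2 : ∀ t, HasDerivAt f₁ (f₂ t) t) (h3 : ∀ t, HasDerivAt f₂ (f₃ t) t)
    (b : ∀ t, |f₃ t| ≤ B) (σ r x y : ℝ) (hx : |x - σ| ≤ r) (hy : |y - σ| ≤ r) :
    |f x - f y - (f₁ σ * (x - y) + f₂ σ / 2 * ((x - σ) ^ 2 - (y - σ) ^ 2))| ≤
      B * r ^ 2 * |x - y| := by
  have d1 : ∀ t, HasDerivAt (fun x => x - σ) 1 t := fun t => (hasDerivAt_id t).sub_const σ
  have := abs_sub_le_of_hasDerivAt (g := fun x => f x -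
      (f₁ σ * (x - σ) + f₂ σ / 2 * (x - σ) ^ 2)) (g' := fun x => f₁ x - (f₁ σ + f₂ σ * (x - σ)))
    (σ := σ) (R := r) (M := B * r ^ 2) (fun t => ?_) (fun t ht => ?_) hx hy
  · convert this using 2
    ring
  · exact ((h1 t).sub (((d1 t).const_mul (f₁ σ)).add
      (((d1 t).pow 2).const_mul (f₂ σ / 2)))).congr_deriv
      (by norm_num; ring)
  · refine (taylor_one hB h2 h3 b σ t).trans ?_
    gcongr

end Taylor

section Frame

/-- The coordinate of `v x - v σ` along the vector `(a, b)`. -/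
def coord (v : ℝ → ℝ × ℝ) (σ a b x : ℝ) : ℝ :=
  a * ((v x).1 - (v σ).1) + b * ((v x).2 - (v σ).2)

/-- Taylor expansion of an arc-length curve at `σ` in its Frenet frame `(a, b)`, `(-b, a)`, with
remainder constants controlled by `B`. -/
structure FrenetExpansion (v : ℝ → ℝ × ℝ) (B σ a b l κ μ : ℝ) : Prop where
  unit : a ^ 2 + b ^ 2 = 1
  abs_l : |l| ≤ B
  abs_κ : |κ| ≤ B
  abs_μ : |μ| ≤ B
  tan : ∀ x, |coord v σ a b x - ((x - σ) + l * (x - σ) ^ 3)| ≤ B * |x - σ| ^ 4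
  nor : ∀ x, |coord v σ (-b) a x - (κ * (x - σ) ^ 2 + μ * (x - σ) ^ 3)| ≤ B * |x - σ| ^ 4
  tan_sub : ∀ r x y, |x - σ| ≤ r → |y - σ| ≤ r →
    |coord v σ a b x - coord v σ a b y - (x - y)| ≤ B * r ^ 2 * |x - y|
  nor_sub : ∀ r x y, |x - σ| ≤ r → |y - σ| ≤ r →
    |coord v σ (-b) a x - coord v σ (-b) a y - κ * ((x - σ) ^ 2 - (y - σ) ^ 2)|
      ≤ B * r ^ 2 * |x - y|

theorem exists_derivs_of_periodic {f : ℝ → ℝ} {L : ℝ} (hL : 0 < L) (hper : ∀ t, f (t + L) = f t)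
    (hf : ContDiff ℝ 4 f) : ∃ f₂ f₃ f₄ : ℝ → ℝ, ∃ B : ℝ,
      (∀ t, HasDerivAt f (deriv f t) t) ∧ (∀ t, HasDerivAt (deriv f) (f₂ t) t) ∧
      (∀ t, HasDerivAt f₂ (f₃ t) t) ∧ (∀ t, HasDerivAt f₃ (f₄ t) t) ∧
      (∀ t, |f t| ≤ B) ∧ (∀ t, |f₂ t| ≤ B) ∧ (∀ t, |f₃ t| ≤ B) ∧ (∀ t, |f₄ t| ≤ B) := by
  have hp : ∀ g : ℝ → ℝ, (∀ t, g (t + L) = g t) → ∀ t, deriv g (t + L) = deriv g t := by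
    intro g hg t
    rw [← deriv_comp_add_const, show (fun x => g (x + L)) = g from funext hg]
  have hb : ∀ g : ℝ → ℝ, Continuous g → (∀ t, g (t + L) = g t) → ∃ B, ∀ t, |g t| ≤ B := by
    intro g hc hg
    obtain ⟨B, hB⟩ := (Function.Periodic.isBounded_of_continuous hg hL.ne' hc).exists_norm_le
    exact ⟨B, fun t => hB _ ⟨t, rfl⟩⟩
  have c1 : ContDiff ℝ 3 (deriv f) := ((contDiff_succ_iff_deriv (n := 3)).1 hf).2.2
  have c2 : ContDiff ℝ 2 (deriv (deriv f)) := ((contDiff_succ_iff_deriv (n := 2)).1 c1).2.2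
  have c3 : ContDiff ℝ 1 (deriv (deriv (deriv f))) :=
    ((contDiff_succ_iff_deriv (n := 1)).1 c2).2.2
  have c4 : ContDiff ℝ 0 (deriv (deriv (deriv (deriv f)))) :=
    ((contDiff_succ_iff_deriv (n := 0)).1 c3).2.2
  have p1 := hp _ hper
  have p2 := hp _ p1
  have p3 := hp _ p2
  have p4 := hp _ p3
  obtain ⟨B0, b0⟩ := hb _ hf.continuous hper
  obtain ⟨B2, b2⟩ := hb _ c2.continuous p2
  obtain ⟨B3, b3⟩ := hb _ c3.continuous p3
  obtain ⟨B4, b4⟩ := hb _ c4.continuous p4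
  refine ⟨_, _, _, max (max B0 B2) (max B3 B4),
    fun t => (hf.differentiable (by norm_num) t).hasDerivAt,
    fun t => (c1.differentiable (by norm_num) t).hasDerivAt,
    fun t => (c2.differentiable (by norm_num) t).hasDerivAt,
    fun t => (c3.differentiable (by norm_num) t).hasDerivAt, fun t => (b0 t).trans (by simp),
    fun t => (b2 t).trans (by simp), fun t => (b3 t).trans (by simp),
    fun t => (b4 t).trans (by simp)⟩

theorem exists_frenetExpansion {v : ℝ → ℝ × ℝ} {L : ℝ} (hL : 0 < L)
    (hper : ∀ t, v (t + L) = v t) (hreg : ContDiff ℝ 4 v)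
    (hunit : ∀ t, dot (deriv v t) (deriv v t) = 1) :
    ∃ B : ℝ, 1 ≤ B ∧ (∀ t, |(v t).1| ≤ B ∧ |(v t).2| ≤ B) ∧
      ∀ σ, ∃ a b l κ μ, FrenetExpansion v B σ a b l κ μ := by
  obtain ⟨u₂, u₃, u₄, Bu, u1, u2, u3, u4, bu0, bu2, bu3, bu4⟩ :=
    exists_derivs_of_periodic (f := fun t => (v t).1) hL (fun t => by rw [hper]) hreg.fst
  obtain ⟨w₂, w₃, w₄, Bw, w1, w2, w3, w4, bw0, bw2, bw3, bw4⟩ :=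
    exists_derivs_of_periodic (f := fun t => (v t).2) hL (fun t => by rw [hper]) hreg.snd
  set u₁ := deriv fun t => (v t).1
  set w₁ := deriv fun t => (v t).2
  have hun : ∀ t, u₁ t ^ 2 + w₁ t ^ 2 = 1 := by
    intro t
    have := hunit t
    rw [((u1 t).prodMk (w1 t)).deriv] at this
    simp only [dot] at this
    linarith
  have horth : ∀ t, u₁ t * u₂ t + w₁ t * w₂ t = 0 := by
    intro t
    have h1 := ((u2 t).pow 2).add ((w2 t).pow 2)
    have h2 : (u₁ ^ 2 + w₁ ^ 2) = fun _ => (1 : ℝ) := funext hun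
    rw [h2] at h1
    have := h1.unique (hasDerivAt_const t 1)
    norm_num at this
    linarith
  have hBu : 0 ≤ Bu := (abs_nonneg _).trans (bu0 0)
  have hBw : 0 ≤ Bw := (abs_nonneg _).trans (bw0 0)
  refine ⟨1 + (Bu + Bw), by linarith,
    fun t => ⟨(bu0 t).trans (by linarith), (bw0 t).trans (by linarith)⟩, fun σ => ?_⟩
  have ha : |u₁ σ| ≤ 1 := by
    rw [← sq_le_one_iff_abs_le_one]; nlinarith [hun σ]
  have hb : |w₁ σ| ≤ 1 := by
    rw [← sq_le_one_iff_abs_le_one]; nlinarith [hun σ]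
  have comb : ∀ a b y z : ℝ, |a| ≤ 1 → |b| ≤ 1 → |y| ≤ Bu → |z| ≤ Bw →
      |a * y + b * z| ≤ 1 + (Bu + Bw) := by
    intro a b y z h1 h2 h3 h4
    refine (abs_add_le _ _).trans ?_
    rw [abs_mul, abs_mul]
    nlinarith [abs_nonneg a, abs_nonneg b, abs_nonneg y, abs_nonneg z]
  have hBB : 0 ≤ 1 + (Bu + Bw) := by linarith
  have key : ∀ a b : ℝ, |a| ≤ 1 → |b| ≤ 1 →
      (∀ x, |coord v σ a b x - ((a * u₁ σ + b * w₁ σ) * (x - σ) +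
        (a * u₂ σ + b * w₂ σ) / 2 * (x - σ) ^ 2 + (a * u₃ σ + b * w₃ σ) / 6 * (x - σ) ^ 3)| ≤
        (1 + (Bu + Bw)) * |x - σ| ^ 4) ∧
      (∀ r x y, |x - σ| ≤ r → |y - σ| ≤ r →
        |coord v σ a b x - coord v σ a b y - ((a * u₁ σ + b * w₁ σ) * (x - y) +
          (a * u₂ σ + b * w₂ σ) / 2 * ((x - σ) ^ 2 - (y - σ) ^ 2))| ≤
          (1 + (Bu + Bw)) * r ^ 2 * |x - y|) := by
    intro a b ha hb
    have g1 : ∀ t, HasDerivAt (coord v σ a b) (a * u₁ t + b * w₁ t) t := fun t =>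
      (((u1 t).sub_const _).const_mul a).add (((w1 t).sub_const _).const_mul b)
    have g2 : ∀ t, HasDerivAt (fun t => a * u₁ t + b * w₁ t) (a * u₂ t + b * w₂ t) t := fun t =>
      ((u2 t).const_mul a).add ((w2 t).const_mul b)
    have g3 : ∀ t, HasDerivAt (fun t => a * u₂ t + b * w₂ t) (a * u₃ t + b * w₃ t) t := fun t =>
      ((u3 t).const_mul a).add ((w3 t).const_mul b)
    have g4 : ∀ t, HasDerivAt (fun t => a * u₃ t + b * w₃ t) (a * u₄ t + b * w₄ t) t := fun t =>
      ((u4 t).const_mul a).add ((w4 t).const_mul b)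
    constructor
    · intro x
      have := taylor_three hBB g1 g2 g3 g4 (fun t => comb a b _ _ ha hb (bu4 t) (bw4 t)) σ x
      rwa [show coord v σ a b σ = 0 by simp [coord], zero_add] at this
    · exact taylor_two_diff hBB g1 g2 g3 (fun t => comb a b _ _ ha hb (bu3 t) (bw3 t)) σ
  have hb' : |-w₁ σ| ≤ 1 := by rwa [abs_neg]
  obtain ⟨t1, t2⟩ := key (u₁ σ) (w₁ σ) ha hb
  obtain ⟨n1, n2⟩ := key (-w₁ σ) (u₁ σ) hb' ha
  have i1 : u₁ σ * u₁ σ + w₁ σ * w₁ σ = 1 := by linarith [hun σ]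
  have i2 : -w₁ σ * u₁ σ + u₁ σ * w₁ σ = 0 := by ring
  have small : ∀ y c : ℝ, 1 ≤ c → |y| ≤ 1 + (Bu + Bw) → |y / c| ≤ 1 + (Bu + Bw) := by
    intro y c hc hy
    rw [abs_div, abs_of_pos (by linarith : (0 : ℝ) < c)]
    exact (div_le_self (abs_nonneg y) hc).trans hy
  refine ⟨u₁ σ, w₁ σ, (u₁ σ * u₃ σ + w₁ σ * w₃ σ) / 6, (-w₁ σ * u₂ σ + u₁ σ * w₂ σ) / 2,
    (-w₁ σ * u₃ σ + u₁ σ * w₃ σ) / 6, hun σ,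
    small _ _ (by norm_num) (comb _ _ _ _ ha hb (bu3 σ) (bw3 σ)),
    small _ _ (by norm_num) (comb _ _ _ _ hb' ha (bu2 σ) (bw2 σ)),
    small _ _ (by norm_num) (comb _ _ _ _ hb' ha (bu3 σ) (bw3 σ)), ?_, ?_, ?_, ?_⟩
  · simpa [i1, horth σ] using t1
  · simpa only [i2, zero_mul, zero_add] using n1
  · simpa [i1, horth σ] using t2
  · simpa only [i2, zero_mul, zero_add] using n2

end Frame

section Mesh

theorem step_le_period {L : ℝ} {n : ℕ} (hn : 1 ≤ n) {x : ℤ → ℝ} (hx : StrictMono x)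
    (hper : ∀ i, x (i + n) = x i + L) (i : ℤ) : x (i + 1) - x i ≤ L := by
  have : x (i + 1) ≤ x (i + n) := hx.monotone (by omega)
  rw [hper] at this
  linarith

theorem exists_step_eq_of_periodic {L : ℝ} {n : ℕ} (hn : 1 ≤ n) {x : ℤ → ℝ}
    (hper : ∀ i, x (i + n) = x i + L) (i : ℤ) :
    ∃ m : ℤ, 0 ≤ m ∧ m < n ∧ x (i + 1) - x i = x (m + 1) - x m := by
  have hp : Function.Periodic (fun i => x (i + 1) - x i) (n : ℤ) := by
    intro i
    have h1 := hper (i + 1)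
    have h2 := hper i
    rw [add_right_comm] at h1
    simp only [h1, h2]
    ring
  refine ⟨i % n, Int.emod_nonneg _ (by omega), Int.emod_lt_of_pos _ (by omega), ?_⟩
  have := hp.sub_zsmul_eq (x := i) (i / n)
  rw [smul_eq_mul, mul_comm, show i - n * (i / n) = i % n by have := Int.emod_add_mul_ediv i n; linarith]
    at this
  exact this.symm

theorem exists_mesh_le {L : ℝ} {N₀ : ℕ} (hN₀ : 1 ≤ N₀) {s : ℕ → ℤ → ℝ}
    (hmono : ∀ j, StrictMono (s j))
    (hsper : ∀ (j : ℕ) (i : ℤ), s j (i + N₀ * 2 ^ j) = s j i + L) {slim : ℝ → ℝ}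
    (hconv : ∀ A : Set ℝ, IsCompact A →
      TendstoUniformlyOn (fun j => plin j (s j)) slim Filter.atTop A) {ε : ℝ} (hε : 0 < ε) :
    ∃ J, ∀ j, J ≤ j → ∀ i, s j (i + 1) - s j i ≤ ε := by
  have hper : ∀ j i, s j (i + (N₀ * 2 ^ j : ℕ)) = s j i + L := by
    intro j i
    push_cast
    exact hsper j i
  have hn : ∀ j, 1 ≤ N₀ * 2 ^ j := fun j => Nat.succ_le_of_lt (by positivity)
  have hstep : ∀ j i, |s j (i + 1) - s j i| ≤ L := fun j i => by
    rw [abs_of_pos (sub_pos.2 (hmono j (lt_add_one i)))]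
    exact step_le_period (hn j) (hmono j) (hper j) i
  have hu := Metric.tendstoUniformlyOn_iff.1 (hconv (Set.Icc 0 N₀) isCompact_Icc) (ε / 8)
    (by positivity)
  obtain ⟨J, hJ⟩ := Filter.eventually_atTop.1 hu
  obtain ⟨m, hm⟩ := exists_pow_lt_of_lt_one (show 0 < ε / 2 / (L + 1) by
    have := (abs_nonneg _).trans (hstep 0 0); positivity) (show (1 / 2 : ℝ) < 1 by norm_num)
  refine ⟨J + m, fun j hj i => ?_⟩
  obtain ⟨k, hk0, hk1, hk⟩ := exists_step_eq_of_periodic (hn j) (hper j) i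
  rw [hk]
  have hL : 0 ≤ L := (abs_nonneg _).trans (hstep 0 0)
  have hpos : (0 : ℝ) < 2 ^ j := by positivity
  have hk0' : (0 : ℝ) ≤ k := by exact_mod_cast hk0
  have hk1' : (k : ℝ) + 1 ≤ N₀ * 2 ^ j := by exact_mod_cast hk1
  have m1 : (k : ℝ) / 2 ^ j ∈ Set.Icc (0 : ℝ) N₀ :=
    ⟨by positivity, by rw [div_le_iff₀ hpos]; linarith⟩
  have m2 : ((k + 1 : ℤ) : ℝ) / 2 ^ j ∈ Set.Icc (0 : ℝ) N₀ :=
    ⟨by positivity, by rw [div_le_iff₀ hpos]; push_cast; linarith⟩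
  have a1 := hJ j (by omega) _ m1
  have a2 := hJ j (by omega) _ m2
  have b1 := hJ J le_rfl _ m1
  have b2 := hJ J le_rfl _ m2
  have c := plin_step_le (J := J) (j := j) (by omega) (hstep J) k
  rw [plin_node] at a1 a2
  rw [Real.dist_eq, abs_lt] at a1 a2 b1 b2
  have d : L * (1 / 2) ^ (j - J) ≤ ε / 2 := by
    have : (1 / 2 : ℝ) ^ (j - J) ≤ (1 / 2) ^ m :=
      pow_le_pow_of_le_one (by norm_num) (by norm_num) (by omega)
    rw [lt_div_iff₀ (by positivity)] at hm
    have h0 : (0 : ℝ) ≤ (1 / 2) ^ m := by positivity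
    nlinarith
  have := le_of_abs_le c
  linarith [a1.1, a1.2, a2.1, a2.2, b1.1, b1.2, b2.1, b2.2]

end Mesh

section Local

/-- One step of the normal transform at a single index `K`: `σ` is the new parameter, `x` are the
old ones, and the chord vector `v σ - S p (v ∘ x)` is orthogonal to `S q (Δ (v ∘ x))`. -/
structure NormalStep (v : ℝ → ℝ × ℝ) (q : ℕ) (K : ℤ) (x : ℤ → ℝ) (σ r : ℝ) : Prop where
  mono : StrictMono x
  near : ∀ i : ℤ, K - 1 ≤ 2 * i → 2 * i ≤ K + (q + 2 : ℕ) → |x i - σ| ≤ r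
  orth : (S (q + 2) (fun i => (v (x i)).1) K - (v σ).1) *
      S q (fun i => (v (x (i + 1))).1 - (v (x i)).1) K +
    (S (q + 2) (fun i => (v (x i)).2) K - (v σ).2) *
      S q (fun i => (v (x (i + 1))).2 - (v (x i)).2) K = 0

theorem S_coord (v : ℝ → ℝ × ℝ) (σ a b : ℝ) (x : ℤ → ℝ) (p : ℕ) (K : ℤ) :
    S p (fun i => coord v σ a b (x i)) K =
      a * (S p (fun i => (v (x i)).1) K - (v σ).1) +
      b * (S p (fun i => (v (x i)).2) K - (v σ).2) := by
  simp only [coord, S_add, S_const_mul, S_sub, S_const]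

theorem S_diff_coord (v : ℝ → ℝ × ℝ) (σ a b : ℝ) (x : ℤ → ℝ) (p : ℕ) (K : ℤ) :
    S p (fun i => coord v σ a b (x (i + 1)) - coord v σ a b (x i)) K =
      a * S p (fun i => (v (x (i + 1))).1 - (v (x i)).1) K +
      b * S p (fun i => (v (x (i + 1))).2 - (v (x i)).2) K := by
  simp only [coord, S_add, S_const_mul, S_sub, S_const]
  ring

variable {v : ℝ → ℝ × ℝ} {q : ℕ} {K : ℤ} {x : ℤ → ℝ} {σ r B a b l κ μ : ℝ}

/-- Deviation of the tangential and normal components of `S q (Δ (v ∘ x))` from their leading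
terms. -/
theorem NormalStep.tangent_estimates (h : NormalStep v q K x σ r)
    (hf : FrenetExpansion v B σ a b l κ μ) :
    0 < S q (fun i => x (i + 1) - x i) K ∧
    |S q (fun i => coord v σ a b (x (i + 1)) - coord v σ a b (x i)) K -
      S q (fun i => x (i + 1) - x i) K| ≤ B * r ^ 2 * S q (fun i => x (i + 1) - x i) K ∧
    |S q (fun i => coord v σ (-b) a (x (i + 1)) - coord v σ (-b) a (x i)) K -
      κ * S q (fun i => (x (i + 1) - σ) ^ 2 - (x i - σ) ^ 2) K|
      ≤ B * r ^ 2 * S q (fun i => x (i + 1) - x i) K := by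
  have hx : ∀ i, 0 < x (i + 1) - x i := fun i => sub_pos.2 (h.mono (lt_add_one i))
  refine ⟨S_pos hx, ?_, ?_⟩
  · rw [← S_sub, ← S_const_mul]
    refine S_abs_le fun i h1 h2 => ?_
    have := hf.tan_sub r _ _ (h.near (i + 1) (by omega) (by push_cast; omega))
      (h.near i (by omega) (by push_cast; omega))
    rwa [abs_of_pos (hx i)] at this
  · rw [← S_const_mul, ← S_sub, ← S_const_mul]
    refine S_abs_le fun i h1 h2 => ?_
    have := hf.nor_sub r _ _ (h.near (i + 1) (by omega) (by push_cast; omega))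
      (h.near i (by omega) (by push_cast; omega))
    rwa [abs_of_pos (hx i)] at this

theorem NormalStep.r_nonneg (h : NormalStep v q K x σ r) : 0 ≤ r :=
  (abs_nonneg _).trans (h.near ((K + 1) / 2) (by omega) (by push_cast; omega))

theorem NormalStep.abs_S_pow_le (h : NormalStep v q K x σ r) (n : ℕ) :
    |S (q + 2) (fun i => (x i - σ) ^ n) K| ≤ r ^ n :=
  S_abs_le_const fun i h1 h2 => by
    rw [abs_pow]
    exact pow_le_pow_left₀ (abs_nonneg _) (h.near i h1 h2) n

theorem FrenetExpansion.B_nonneg (hf : FrenetExpansion v B σ a b l κ μ) : 0 ≤ B :=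
  (abs_nonneg _).trans hf.abs_l

/-- If the normal component of the tangent vector is at most `ω` relative to the mesh, then the
tangential defect `S p (x - σ) + l S p (x - σ)³` is of order `r² ω + r⁴`. -/
theorem NormalStep.defect_le {ω : ℝ} (h : NormalStep v q K x σ r)
    (hf : FrenetExpansion v B σ a b l κ μ) (hr : B * r ^ 2 ≤ 1 / 2) (hr1 : r ≤ 1)
    (hω : |S q (fun i => coord v σ (-b) a (x (i + 1)) - coord v σ (-b) a (x i)) K| ≤
      ω * S q (fun i => x (i + 1) - x i) K) :
    |S (q + 2) (fun i => x i - σ) K + l * S (q + 2) (fun i => (x i - σ) ^ 3) K| ≤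
      6 * B * r ^ 2 * ω + B * r ^ 4 := by
  obtain ⟨hD, hT, -⟩ := h.tangent_estimates hf
  have hB := hf.B_nonneg
  have hr0 := h.r_nonneg
  have e1 := S_coord v σ a b x (q + 2) K
  have e2 := S_coord v σ (-b) a x (q + 2) K
  have e3 := S_diff_coord v σ a b x q K
  have e4 := S_diff_coord v σ (-b) a x q K
  have o := h.orth
  have eF : |S (q + 2) (fun i => coord v σ a b (x i)) K -
      (S (q + 2) (fun i => x i - σ) K + l * S (q + 2) (fun i => (x i - σ) ^ 3) K)| ≤
      B * r ^ 4 := by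
    rw [← S_const_mul, ← S_add, ← S_sub]
    refine S_abs_le_const fun i h1 h2 => (hf.tan (x i)).trans ?_
    have := h.near i h1 h2
    gcongr
  have eG : |S (q + 2) (fun i => coord v σ (-b) a (x i)) K| ≤ 3 * B * r ^ 2 := by
    refine S_abs_le_const fun i h1 h2 => ?_
    have hi := h.near i h1 h2
    have h3 := hf.nor (x i)
    have h4 : |κ * (x i - σ) ^ 2| ≤ B * r ^ 2 := by
      rw [abs_mul, abs_pow]
      exact mul_le_mul hf.abs_κ (by gcongr) (by positivity) hB
    have h5 : |μ * (x i - σ) ^ 3| ≤ B * r ^ 3 := by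
      rw [abs_mul, abs_pow]
      exact mul_le_mul hf.abs_μ (by gcongr) (by positivity) hB
    have h6 : B * |x i - σ| ^ 4 ≤ B * r ^ 4 := by gcongr
    have h7 : r ^ 3 ≤ r ^ 2 := pow_le_pow_of_le_one hr0 hr1 (by norm_num)
    have h8 : r ^ 4 ≤ r ^ 2 := pow_le_pow_of_le_one hr0 hr1 (by norm_num)
    have h9 := mul_le_mul_of_nonneg_left h7 hB
    have h10 := mul_le_mul_of_nonneg_left h8 hB
    rw [abs_le] at *
    constructor <;> linarith [h3.1, h3.2, h4.1, h4.2, h5.1, h5.2]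
  set D := S q (fun i => x (i + 1) - x i) K
  set F := S (q + 2) (fun i => coord v σ a b (x i)) K
  set G := S (q + 2) (fun i => coord v σ (-b) a (x i)) K
  set Wt := S q (fun i => coord v σ a b (x (i + 1)) - coord v σ a b (x i)) K
  set Wn := S q (fun i => coord v σ (-b) a (x (i + 1)) - coord v σ (-b) a (x i)) K
  have hFG : F * Wt + G * Wn = 0 := by
    rw [e1, e2, e3, e4]
    have := hf.unit
    linear_combination (a ^ 2 + b ^ 2) * o
  have hWt : D / 2 ≤ Wt := by
    have := (abs_le.1 hT).1
    nlinarith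
  have hω0 : 0 ≤ ω * D := (abs_nonneg _).trans hω
  have hF : |F| * (D / 2) ≤ 3 * B * r ^ 2 * (ω * D) := by
    calc |F| * (D / 2) ≤ |F| * Wt := by gcongr
      _ = |F * Wt| := by rw [abs_mul, abs_of_pos (by linarith : 0 < Wt)]
      _ = |G * Wn| := by rw [eq_neg_of_add_eq_zero_left hFG, abs_neg]
      _ = |G| * |Wn| := abs_mul _ _
      _ ≤ _ := mul_le_mul eG hω (abs_nonneg _) (by positivity)
  have hF' : |F| ≤ 6 * B * r ^ 2 * ω := by
    by_contra hc
    push Not at hc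
    nlinarith
  rw [abs_le] at *
  constructor <;> linarith [hF'.1, hF'.2, eF.1, eF.2]

end Local

section Approximation

variable {p q N : ℕ} {K : ℤ} {x : ℤ → ℝ} {σ r B a b l κ μ : ℝ} {v : ℝ → ℝ × ℝ}

theorem abs_center_sub_le (hN : p ≤ N) (hp : 1 ≤ p) (K : ℤ) :
    |center p K - (K / 2 : ℤ)| ≤ N := by
  have h1 : ((K / 2 * 2 : ℤ) : ℝ) ≤ K := by exact_mod_cast Int.ediv_mul_le K (by norm_num)
  have h2 : (K : ℝ) ≤ ((K / 2 * 2 + 1 : ℤ) : ℝ) := by exact_mod_cast (by omega)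
  push_cast at h1 h2
  have h3 : (p : ℝ) ≤ N := by exact_mod_cast hN
  have h4 : (1 : ℝ) ≤ p := by exact_mod_cast hp
  rw [center, abs_le]
  constructor <;> linarith

theorem abs_sub_center_le (hN : p ≤ N) (hp : 1 ≤ p) {i : ℤ} (hi : |i - K / 2| ≤ N) :
    |(i : ℝ) - center p K| ≤ 2 * N := by
  have h1 := abs_center_sub_le hN hp K
  have h2 : |(i : ℝ) - (K / 2 : ℤ)| ≤ N := by exact_mod_cast hi
  rw [abs_le] at *
  constructor <;> linarith [h1.1, h1.2, h2.1, h2.2]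

theorem abs_sub_half_le (hN : p + 1 ≤ N) {i : ℤ} (h1 : K - 1 ≤ 2 * i) (h2 : 2 * i ≤ K + p) :
    |i - K / 2| ≤ N := by
  rw [abs_le]
  constructor <;> omega

theorem abs_sub_affine_center_le (hp : 1 ≤ p) (hN : p + 1 ≤ N) {M₀ M₂ : ℝ}
    (h₀ : |S p (fun i => x i - σ) K| ≤ M₀)
    (h₂ : ∀ i, |x (i + 2) - 2 * x (i + 1) + x i| ≤ M₂) {i : ℤ} (hi : |i - K / 2| ≤ N) :
    |x i - σ - (x (K / 2 + 1) - x (K / 2)) * (i - center p K)| ≤ M₀ + 2 * N ^ 2 * M₂ := by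
  have hA : ∀ i : ℤ, |i - K / 2| ≤ N → _ := fun i hi => abs_sub_affine_le h₂ i hi
  set m := K / 2
  set d := x (m + 1) - x m
  set α := x m - σ + d * (center p K - m)
  have e : S p (fun i => x i - (x m + (i - m) * d)) K = S p (fun i => x i - σ) K - α := by
    have hc : S p (fun i => (i : ℝ) - center p K) K = 0 := by
      obtain ⟨k, rfl⟩ := Nat.exists_eq_add_of_le' hp
      exact S_sub_center k K
    rw [show (fun i : ℤ => x i - (x m + (i - m) * d)) =
      fun i : ℤ => (x i - σ) - (α + d * ((i : ℝ) - center p K)) by ext i; simp only [α]; ring,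
      S_sub, S_add, S_const, S_const_mul, hc]
    ring
  have h3 := S_abs_le_const (p := p) (K := K) (x := fun i => x i - (x m + (i - m) * d))
    fun i h1 h2 => hA i (abs_sub_half_le hN h1 h2)
  rw [e] at h3
  have h4 := hA i hi
  have e2 : x i - σ - d * (i - center p K) = (x i - (x m + (i - m) * d)) + α := by
    simp only [α]; ring
  rw [e2]
  rw [abs_le] at *
  constructor <;> linarith [h3.1, h3.2, h4.1, h4.2]

theorem exists_quadratic_center (hp : 3 ≤ p) (hN : p + 1 ≤ N) {M₀ M₁ M₂ M₃ : ℝ}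
    (h₀ : |S p (fun i => x i - σ) K| ≤ M₀) (h₁ : ∀ i, |x (i + 1) - x i| ≤ M₁)
    (h₂ : ∀ i, |x (i + 2) - 2 * x (i + 1) + x i| ≤ M₂)
    (h₃ : ∀ i, |x (i + 3) - 3 * x (i + 2) + 3 * x (i + 1) - x i| ≤ M₃) :
    ∃ α d β : ℝ, |α| ≤ M₀ + N * M₂ + N ^ 3 * M₃ ∧ |d| ≤ M₁ + (N + 1) * M₂ ∧ |β| ≤ M₂ ∧
      ∀ i : ℤ, |i - K / 2| ≤ N →
        |x i - σ - (α + d * (i - center p K) + β * (i - center p K) ^ 2)| ≤ N ^ 3 * M₃ := by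
  have hQ : ∀ i : ℤ, |i - K / 2| ≤ N → _ := fun i hi => abs_sub_quadratic_le h₃ i hi
  have hδ := abs_center_sub_le (p := p) (N := N) (by omega) (by omega) K
  set m := K / 2
  set d₁ := x (m + 1) - x m
  set d₂ := x (m + 2) - 2 * x (m + 1) + x m
  set δ := center p K - m
  have hd₁ : |d₁| ≤ M₁ := h₁ m
  have hd₂ : |d₂| ≤ M₂ := h₂ m
  set α := x m - σ + d₁ * δ + d₂ / 2 * (δ * (δ - 1))
  have ex : ∀ i : ℤ, x i - σ - (α + (d₁ + d₂ * (δ - 1 / 2)) * (i - center p K) +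
      d₂ / 2 * (i - center p K) ^ 2) =
      x i - (x m + (i - m) * d₁ + (i - m) * (i - m - 1) / 2 * d₂) := by
    intro i
    simp only [α, δ]
    ring
  have hM₂ : 0 ≤ M₂ := (abs_nonneg _).trans hd₂
  refine ⟨α, d₁ + d₂ * (δ - 1 / 2), d₂ / 2, ?_, ?_, ?_, fun i hi => ?_⟩
  · have h3 := S_abs_le_const (p := p) (K := K)
      (x := fun i => x i - (x m + (i - m) * d₁ + (i - m) * (i - m - 1) / 2 * d₂))
      fun i h1 h2 => hQ i (abs_sub_half_le hN h1 h2)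
    have hc : S p (fun i => (i : ℝ) - center p K) K = 0 ∧
        S p (fun i => ((i : ℝ) - center p K) ^ 2) K = ((p : ℝ) + 1) / 16 := by
      obtain ⟨k, rfl⟩ := Nat.exists_eq_add_of_le' hp
      refine ⟨S_sub_center (k + 2) K, ?_⟩
      rw [(S_center_moments k K).1]
      push_cast
      ring
    simp only [← ex] at h3
    rw [S_sub, S_add, S_add, S_const, S_const_mul, S_const_mul, hc.1, hc.2] at h3
    have h4 : |d₂ / 2 * (((p : ℝ) + 1) / 16)| ≤ N * M₂ := by
      have : (p : ℝ) + 1 ≤ N := by exact_mod_cast hN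
      rw [abs_mul, abs_div, abs_of_pos (show (0 : ℝ) < 2 by norm_num),
        abs_of_pos (show 0 < ((p : ℝ) + 1) / 16 by positivity), mul_comm]
      apply mul_le_mul _ _ (by positivity) (by positivity) <;> linarith [abs_nonneg d₂]
    rw [abs_le] at *
    constructor <;> linarith [h₀.1, h₀.2, h3.1, h3.2, h4.1, h4.2]
  · have h4 : |d₂ * (δ - 1 / 2)| ≤ M₂ * (N + 1) := by
      rw [abs_mul]
      refine mul_le_mul hd₂ ?_ (abs_nonneg _) hM₂
      rw [abs_le] at *
      constructor <;> linarith [hδ.1, hδ.2]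
    refine (abs_add_le _ _).trans ?_
    linarith
  · rw [abs_div, abs_of_pos (show (0 : ℝ) < 2 by norm_num)]
    linarith [abs_nonneg d₂]
  · rw [ex]
    exact hQ i hi

/-- If `x` is affine about the new parameter up to `E`, the normal component of the tangent vector
is small relative to the mesh. -/
theorem S_diff_sq_le {d E : ℝ} (hx : StrictMono x) (hq : 1 ≤ q) (hN : q + 3 ≤ N)
    (hE : ∀ i : ℤ, |i - K / 2| ≤ N → |x i - σ - d * (i - center (q + 2) K)| ≤ E) :
    |S q (fun i => (x (i + 1) - σ) ^ 2 - (x i - σ) ^ 2) K| ≤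
      (16 * N + 2) * E * S q (fun i => x (i + 1) - x i) K := by
  have hpos : ∀ i, 0 < x (i + 1) - x i := fun i => sub_pos.2 (hx (lt_add_one i))
  have hE0 : 0 ≤ E := (abs_nonneg _).trans (hE (K / 2) (by simp))
  have hcc : center (q + 2) K = center q K + 1 / 2 := by
    simp only [center]; push_cast; ring
  have win : ∀ i : ℤ, K - 1 ≤ 2 * i → 2 * i ≤ K + q →
      |i - K / 2| ≤ N ∧ |i + 1 - K / 2| ≤ N := fun i h1 h2 => by
    rw [abs_le, abs_le]; refine ⟨⟨?_, ?_⟩, ?_, ?_⟩ <;> omega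
  have hc : S q (fun i => (i : ℝ) - center q K) K = 0 := by
    obtain ⟨k, rfl⟩ := Nat.exists_eq_add_of_le' hq
    exact S_sub_center k K
  have hΔ : ∀ i : ℤ, K - 1 ≤ 2 * i → 2 * i ≤ K + q → |x (i + 1) - x i - d| ≤ 2 * E := by
    intro i h1 h2
    have e1 := hE i (win i h1 h2).1
    have e2 := hE (i + 1) (win i h1 h2).2
    push_cast at e2
    rw [abs_le] at *
    constructor <;> linarith [e1.1, e1.2, e2.1, e2.2]
  have hD : |S q (fun i => x (i + 1) - x i) K - d| ≤ 2 * E := by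
    have : S q (fun i => x (i + 1) - x i - d) K = S q (fun i => x (i + 1) - x i) K - d := by
      rw [S_sub, S_const]
    rw [← this]
    exact S_abs_le_const hΔ
  have hX1 : |S q (fun i => (x (i + 1) - x i) * (i - center q K)) K| ≤
      2 * N * S q (fun i => x (i + 1) - x i) K := by
    rw [← S_const_mul]
    refine S_abs_le fun i h1 h2 => ?_
    rw [abs_mul, abs_of_pos (hpos i), mul_comm]
    exact mul_le_mul_of_nonneg_right
      (abs_sub_center_le (by omega) hq (win i h1 h2).1) (hpos i).le
  have hX2 : |S q (fun i => (x (i + 1) - x i) * (i - center q K)) K| ≤ 2 * E * (2 * N) := by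
    have : S q (fun i => (x (i + 1) - x i) * (i - center q K)) K =
        S q (fun i => (x (i + 1) - x i - d) * (i - center q K)) K := by
      simp only [sub_mul _ d]
      rw [S_sub, S_const_mul q d, hc]
      ring
    rw [this]
    refine S_abs_le_const fun i h1 h2 => ?_
    rw [abs_mul]
    exact mul_le_mul (hΔ i h1 h2) (abs_sub_center_le (by omega) hq (win i h1 h2).1)
      (abs_nonneg _) (by positivity)
  have hQ : |S q (fun i => (x (i + 1) - σ) ^ 2 - (x i - σ) ^ 2) K -
      2 * d * S q (fun i => (x (i + 1) - x i) * (i - center q K)) K| ≤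
      2 * E * S q (fun i => x (i + 1) - x i) K := by
    rw [← S_const_mul, ← S_const_mul, ← S_sub]
    refine S_abs_le fun i h1 h2 => ?_
    have e1 := hE i (win i h1 h2).1
    have e2 := hE (i + 1) (win i h1 h2).2
    rw [hcc] at e1 e2
    push_cast at e2
    have : (x (i + 1) - σ) ^ 2 - (x i - σ) ^ 2 - 2 * d * ((x (i + 1) - x i) * (i - center q K)) =
        ((x i - σ - d * (i - (center q K + 1 / 2))) +
          (x (i + 1) - σ - d * (i + 1 - (center q K + 1 / 2)))) * (x (i + 1) - x i) := by ring
    rw [this, abs_mul, abs_of_pos (hpos i)]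
    refine mul_le_mul_of_nonneg_right ?_ (hpos i).le
    exact (abs_add_le _ _).trans (by linarith)
  have hDpos : 0 < S q (fun i => x (i + 1) - x i) K := S_pos hpos
  set D := S q (fun i => x (i + 1) - x i) K
  set X := S q (fun i => (x (i + 1) - x i) * (i - center q K)) K
  have hdX : |d| * |X| ≤ 8 * N * E * D := by
    have h1 : |d| ≤ D + 2 * E := by
      rw [abs_le] at *
      constructor <;> linarith [hD.1, hD.2]
    calc |d| * |X| ≤ (D + 2 * E) * |X| := by gcongr
      _ = D * |X| + 2 * E * |X| := by ring
      _ ≤ D * (2 * E * (2 * N)) + 2 * E * (2 * N * D) := by gcongr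
      _ = _ := by ring
  have h2 : |2 * d * X| ≤ 16 * N * E * D := by
    rw [abs_mul, abs_mul, abs_of_pos (show (0 : ℝ) < 2 by norm_num)]
    linarith
  rw [abs_le] at *
  constructor <;> linarith [hQ.1, hQ.2, h2.1, h2.2]

theorem abs_cube_sub_cube_le {y z E R : ℝ} (h : |y - z| ≤ E) (hy : |y| ≤ R) (hz : |z| ≤ R) :
    |y ^ 3 - z ^ 3| ≤ 3 * R ^ 2 * E := by
  have hR : 0 ≤ R := (abs_nonneg _).trans hy
  have : y ^ 3 - z ^ 3 = (y - z) * (y * y + y * z + z * z) := by ring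
  rw [this, abs_mul, mul_comm]
  refine mul_le_mul ?_ h (abs_nonneg _) (by positivity)
  calc |y * y + y * z + z * z| ≤ |y * y| + |y * z| + |z * z| :=
        (abs_add_le _ _).trans (add_le_add_left (abs_add_le _ _) _)
    _ ≤ R * R + R * R + R * R := by simp only [abs_mul]; gcongr
    _ = 3 * R ^ 2 := by ring

theorem NormalStep.abs_S_cube_le {d E R : ℝ} (h : NormalStep v q K x σ r) (hq : 1 ≤ q)
    (hN : q + 3 ≤ N)
    (hE : ∀ i : ℤ, |i - K / 2| ≤ N → |x i - σ - d * (i - center (q + 2) K)| ≤ E)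
    (hrR : r ≤ R) (hdR : |d| * (2 * N) ≤ R) :
    |S (q + 2) (fun i => (x i - σ) ^ 3) K| ≤ 3 * R ^ 2 * E := by
  have hc : S (q + 2) (fun i => ((i : ℝ) - center (q + 2) K) ^ 3) K = 0 := by
    obtain ⟨k, rfl⟩ := Nat.exists_eq_add_of_le' hq
    exact (S_center_moments k K).2
  have : S (q + 2) (fun i => (x i - σ) ^ 3) K =
      S (q + 2) (fun i => (x i - σ) ^ 3 - d ^ 3 * ((i : ℝ) - center (q + 2) K) ^ 3) K := by
    rw [S_sub, S_const_mul, hc]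
    ring
  rw [this]
  refine S_abs_le_const fun i h1 h2 => ?_
  have hi := abs_sub_half_le (N := N) (by omega) h1 h2
  rw [← mul_pow]
  refine abs_cube_sub_cube_le (hE i hi) ((h.near i h1 h2).trans hrR) ?_
  rw [abs_mul]
  exact (mul_le_mul_of_nonneg_left (abs_sub_center_le (by omega) (by omega) hi)
    (abs_nonneg _)).trans hdR

theorem NormalStep.normal_le {ω : ℝ} (h : NormalStep v q K x σ r)
    (hf : FrenetExpansion v B σ a b l κ μ)
    (hω : |S q (fun i => (x (i + 1) - σ) ^ 2 - (x i - σ) ^ 2) K| ≤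
      ω * S q (fun i => x (i + 1) - x i) K) :
    |S q (fun i => coord v σ (-b) a (x (i + 1)) - coord v σ (-b) a (x i)) K| ≤
      (B * ω + B * r ^ 2) * S q (fun i => x (i + 1) - x i) K := by
  obtain ⟨-, -, h1⟩ := h.tangent_estimates hf
  have hB := hf.B_nonneg
  have h2 : |κ * S q (fun i => (x (i + 1) - σ) ^ 2 - (x i - σ) ^ 2) K| ≤
      B * (ω * S q (fun i => x (i + 1) - x i) K) := by
    rw [abs_mul]
    exact mul_le_mul hf.abs_κ hω (abs_nonneg _) hB
  rw [abs_le] at *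
  constructor <;> linarith [h1.1, h1.2, h2.1, h2.2]

theorem NormalStep.abs_S_diff_sq_le (h : NormalStep v q K x σ r) :
    |S q (fun i => (x (i + 1) - σ) ^ 2 - (x i - σ) ^ 2) K| ≤
      2 * r * S q (fun i => x (i + 1) - x i) K := by
  have hpos : ∀ i, 0 < x (i + 1) - x i := fun i => sub_pos.2 (h.mono (lt_add_one i))
  rw [← S_const_mul]
  refine S_abs_le fun i h1 h2 => ?_
  have e1 := h.near (i + 1) (by omega) (by push_cast; omega)
  have e2 := h.near i (by omega) (by push_cast; omega)
  rw [show (x (i + 1) - σ) ^ 2 - (x i - σ) ^ 2 =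
    ((x (i + 1) - σ) + (x i - σ)) * (x (i + 1) - x i) by ring, abs_mul, abs_of_pos (hpos i)]
  exact mul_le_mul_of_nonneg_right ((abs_add_le _ _).trans (by linarith)) (hpos i).le

/-- The crude bound: the new parameter agrees with `S p x` up to third order in the mesh. -/
theorem NormalStep.abs_S_sub_le_cube (h : NormalStep v q K x σ r)
    (hf : FrenetExpansion v B σ a b l κ μ) (hr : B * r ^ 2 ≤ 1 / 2) (hr1 : r ≤ 1) :
    |S (q + 2) (fun i => x i - σ) K| ≤ (18 * B ^ 2 + 2 * B) * r ^ 3 := by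
  have hB := hf.B_nonneg
  have hr0 := h.r_nonneg
  have h1 := h.defect_le hf hr hr1 (h.normal_le hf h.abs_S_diff_sq_le)
  have h2 : |l * S (q + 2) (fun i => (x i - σ) ^ 3) K| ≤ B * r ^ 3 := by
    rw [abs_mul]
    exact mul_le_mul hf.abs_l (h.abs_S_pow_le 3) (abs_nonneg _) hB
  have h3 : r ^ 4 ≤ r ^ 3 := pow_le_pow_of_le_one hr0 hr1 (by norm_num)
  have h4 := mul_le_mul_of_nonneg_left h3 hB
  have h5 := mul_le_mul_of_nonneg_left h4 hB
  rw [abs_le] at *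
  constructor <;> nlinarith [h1.1, h1.2, h2.1, h2.2]

/-- The refined bound for almost affine parameters. -/
theorem NormalStep.abs_S_sub_le_of_affine {d E R : ℝ} (h : NormalStep v q K x σ r)
    (hf : FrenetExpansion v B σ a b l κ μ) (hr : B * r ^ 2 ≤ 1 / 2) (hr1 : r ≤ 1) (hq : 1 ≤ q)
    (hN : q + 3 ≤ N)
    (hE : ∀ i : ℤ, |i - K / 2| ≤ N → |x i - σ - d * (i - center (q + 2) K)| ≤ E)
    (hrR : r ≤ R) (hdR : |d| * (2 * N) ≤ R) :
    |S (q + 2) (fun i => x i - σ) K| ≤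
      6 * B * r ^ 2 * (B * ((16 * N + 2) * E) + B * r ^ 2) + B * r ^ 4 + B * (3 * R ^ 2 * E) := by
  have hB := hf.B_nonneg
  have h1 := h.defect_le hf hr hr1 (h.normal_le hf (S_diff_sq_le h.mono hq hN hE))
  have h2 : |l * S (q + 2) (fun i => (x i - σ) ^ 3) K| ≤ B * (3 * R ^ 2 * E) := by
    rw [abs_mul]
    exact mul_le_mul hf.abs_l (h.abs_S_cube_le hq hN hE hrR hdR) (abs_nonneg _) hB
  rw [abs_le] at *
  constructor <;> linarith [h1.1, h1.2, h2.1, h2.2]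

end Approximation

section Prediction

theorem abs_dot_perp_le {a b ω : ℝ} {u w : ℝ × ℝ} (hab : a ^ 2 + b ^ 2 = 1)
    (hpos : 0 < a * w.1 + b * w.2) (hω : |-b * w.1 + a * w.2| ≤ ω * (a * w.1 + b * w.2)) :
    |dot u ((enorm2 w)⁻¹ • perp w)| ≤ |-b * u.1 + a * u.2| + |a * u.1 + b * u.2| * ω := by
  have hn : a * w.1 + b * w.2 ≤ enorm2 w := by
    refine Real.le_sqrt_of_sq_le ?_
    nlinarith [sq_nonneg (-b * w.1 + a * w.2)]
  have hn0 : 0 < enorm2 w := hpos.trans_le hn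
  have e : dot u ((enorm2 w)⁻¹ • perp w) = ((-b * u.1 + a * u.2) * (a * w.1 + b * w.2) -
      (a * u.1 + b * u.2) * (-b * w.1 + a * w.2)) / enorm2 w := by
    simp only [dot, perp, Prod.smul_fst, Prod.smul_snd, smul_eq_mul]
    field_simp
    linear_combination (u.1 * w.2 - u.2 * w.1) * hab
  have hω0 : 0 ≤ ω := by
    by_contra hc
    nlinarith [abs_nonneg (-b * w.1 + a * w.2)]
  rw [e, abs_div, abs_of_pos hn0, div_le_iff₀ hn0]
  calc _ ≤ |-b * u.1 + a * u.2| * (a * w.1 + b * w.2) +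
        |a * u.1 + b * u.2| * |-b * w.1 + a * w.2| := by
        refine (abs_sub _ _).trans ?_
        rw [abs_mul, abs_mul, abs_of_pos hpos]
    _ ≤ |-b * u.1 + a * u.2| * (a * w.1 + b * w.2) +
        |a * u.1 + b * u.2| * (ω * (a * w.1 + b * w.2)) := by gcongr
    _ = (|-b * u.1 + a * u.2| + |a * u.1 + b * u.2| * ω) * (a * w.1 + b * w.2) := by ring
    _ ≤ _ := by gcongr

/-- A prediction row `m` on the index set `I`, reproducing cubics at `c`. -/
structure CubicRow (I : Finset ℤ) (m : ℤ → ℝ) (c W : ℝ) : Prop where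
  one : ∑ k ∈ I, m k = 1
  fst : ∑ k ∈ I, m k * ((k : ℝ) - c) = 0
  snd : ∑ k ∈ I, m k * ((k : ℝ) - c) ^ 2 = 0
  trd : ∑ k ∈ I, m k * ((k : ℝ) - c) ^ 3 = 0
  weights_le : ∑ k ∈ I, |m k| ≤ W

variable {I : Finset ℤ} {m : ℤ → ℝ} {c W : ℝ}

theorem CubicRow.W_nonneg (h : CubicRow I m c W) : 0 ≤ W :=
  (Finset.sum_nonneg fun _ _ => abs_nonneg _).trans h.weights_le

theorem CubicRow.abs_sum_le (h : CubicRow I m c W) {y : ℤ → ℝ} {M : ℝ}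
    (hM : 0 ≤ M) (hy : ∀ k ∈ I, |y k| ≤ M) : |∑ k ∈ I, m k * y k| ≤ W * M := by
  calc |∑ k ∈ I, m k * y k| ≤ ∑ k ∈ I, |m k * y k| := Finset.abs_sum_le_sum_abs _ _
    _ ≤ ∑ k ∈ I, |m k| * M := Finset.sum_le_sum fun k hk => by
        rw [abs_mul]; exact mul_le_mul_of_nonneg_left (hy k hk) (abs_nonneg _)
    _ = (∑ k ∈ I, |m k|) * M := by rw [Finset.sum_mul]
    _ ≤ W * M := mul_le_mul_of_nonneg_right h.weights_le hM

theorem CubicRow.abs_sum_sub_le (h : CubicRow I m c W) {y : ℤ → ℝ} {M α₀ α₁ α₂ α₃ : ℝ}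
    (hM : 0 ≤ M) (hy : ∀ k ∈ I, |y k - (α₀ + α₁ * ((k : ℝ) - c) + α₂ * ((k : ℝ) - c) ^ 2 +
      α₃ * ((k : ℝ) - c) ^ 3)| ≤ M) : |∑ k ∈ I, m k * y k - α₀| ≤ W * M := by
  have e : ∑ k ∈ I, m k * y k - α₀ = ∑ k ∈ I, m k * (y k - (α₀ + α₁ * ((k : ℝ) - c) +
      α₂ * ((k : ℝ) - c) ^ 2 + α₃ * ((k : ℝ) - c) ^ 3)) := by
    have : ∀ k, m k * (y k - (α₀ + α₁ * ((k : ℝ) - c) + α₂ * ((k : ℝ) - c) ^ 2 +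
        α₃ * ((k : ℝ) - c) ^ 3)) = m k * y k - (α₀ * m k + α₁ * (m k * ((k : ℝ) - c)) +
        α₂ * (m k * ((k : ℝ) - c) ^ 2) + α₃ * (m k * ((k : ℝ) - c) ^ 3)) := fun k => by ring
    simp only [this, Finset.sum_sub_distrib, Finset.sum_add_distrib, ← Finset.mul_sum, h.one,
      h.fst, h.snd, h.trd]
    ring
  rw [e]
  exact h.abs_sum_le hM hy

theorem abs_sq_sub_sq_le {y z E R : ℝ} (h : |y - z| ≤ E) (hy : |y| ≤ R) (hz : |z| ≤ R) :
    |y ^ 2 - z ^ 2| ≤ 2 * R * E := by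
  have hR : 0 ≤ R := (abs_nonneg _).trans hy
  rw [show y ^ 2 - z ^ 2 = (y - z) * (y + z) by ring, abs_mul, mul_comm]
  exact mul_le_mul ((abs_add_le _ _).trans (by linarith)) h (abs_nonneg _) (by positivity)

variable {v : ℝ → ℝ × ℝ} {x : ℤ → ℝ} {σ B a b l κ μ α d β E E₃ R : ℝ}

/-- The tangential and normal defects of a cubic prediction row applied to `v ∘ x`, when `x` is
almost quadratic. -/
theorem CubicRow.coord_le (h : CubicRow I m c W) (hf : FrenetExpansion v B σ a b l κ μ)
    (hR1 : R ≤ 1) (hR : ∀ k ∈ I, |x k - σ| ≤ R)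
    (hα : |α| ≤ E) (hβ : ∀ k ∈ I, |α + β * ((k : ℝ) - c) ^ 2| ≤ E)
    (hd : ∀ k ∈ I, |d * ((k : ℝ) - c)| ≤ R)
    (hu : ∀ k ∈ I, |α + d * ((k : ℝ) - c) + β * ((k : ℝ) - c) ^ 2| ≤ R)
    (hx : ∀ k ∈ I, |x k - σ - (α + d * ((k : ℝ) - c) + β * ((k : ℝ) - c) ^ 2)| ≤ E₃)
    (hR0 : 0 ≤ R) (hE₃ : 0 ≤ E₃) :
    |∑ k ∈ I, m k * coord v σ a b (x k)| ≤ E + W * E₃ + W * (2 * B * R ^ 3) ∧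
    |∑ k ∈ I, m k * coord v σ (-b) a (x k)| ≤
      B * (E ^ 2 + W * (E ^ 2 + 2 * R * E₃)) + B * (W * (3 * R ^ 2 * (E + E₃))) +
        W * (B * R ^ 4) := by
  have hB := hf.B_nonneg
  have hE : 0 ≤ E := (abs_nonneg _).trans hα
  have hW := h.W_nonneg
  have y1 : |∑ k ∈ I, m k * (x k - σ)| ≤ E + W * E₃ := by
    have := h.abs_sum_sub_le (y := fun k => x k - σ) (α₀ := α) (α₁ := d) (α₂ := β) (α₃ := 0)
      hE₃ fun k hk => by simpa using hx k hk
    rw [abs_le] at *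
    constructor <;> linarith [this.1, this.2, hα.1, hα.2]
  have y2 : |∑ k ∈ I, m k * (x k - σ) ^ 2| ≤ E ^ 2 + W * (E ^ 2 + 2 * R * E₃) := by
    have hα2 : |α ^ 2| ≤ E ^ 2 := by rw [abs_pow]; gcongr
    have := h.abs_sum_sub_le (y := fun k => (x k - σ) ^ 2) (α₀ := 0) (α₁ := 2 * α * d)
      (α₂ := d ^ 2) (α₃ := 2 * d * β) (M := E ^ 2 + 2 * R * E₃) (by positivity) fun k hk => by
        have h1 := abs_sq_sub_sq_le (hx k hk) (hR k hk) (hu k hk)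
        have h2 : |(α + β * ((k : ℝ) - c) ^ 2) ^ 2| ≤ E ^ 2 := by
          rw [abs_pow]; exact pow_le_pow_left₀ (abs_nonneg _) (hβ k hk) 2
        rw [show (x k - σ) ^ 2 - (0 + 2 * α * d * ((k : ℝ) - c) + d ^ 2 * ((k : ℝ) - c) ^ 2 +
          2 * d * β * ((k : ℝ) - c) ^ 3) = ((x k - σ) ^ 2 -
            (α + d * ((k : ℝ) - c) + β * ((k : ℝ) - c) ^ 2) ^ 2) +
            (α + β * ((k : ℝ) - c) ^ 2) ^ 2 by ring]
        exact (abs_add_le _ _).trans (by linarith)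
    rw [sub_zero] at this
    have h0 : 0 ≤ E ^ 2 := by positivity
    linarith
  have y3 : |∑ k ∈ I, m k * (x k - σ) ^ 3| ≤ W * (3 * R ^ 2 * (E + E₃)) := by
    have := h.abs_sum_sub_le (y := fun k => (x k - σ) ^ 3) (α₀ := 0) (α₁ := 0)
      (α₂ := 0) (α₃ := d ^ 3) (M := 3 * R ^ 2 * (E + E₃)) (by positivity) fun k hk => by
        rw [show (0 : ℝ) + 0 * ((k : ℝ) - c) + 0 * ((k : ℝ) - c) ^ 2 + d ^ 3 * ((k : ℝ) - c) ^ 3 =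
          (d * ((k : ℝ) - c)) ^ 3 by ring]
        refine abs_cube_sub_cube_le ?_ (hR k hk) (hd k hk)
        have h1 := hx k hk
        have h2 := hβ k hk
        rw [abs_le] at *
        constructor <;> linarith [h1.1, h1.2, h2.1, h2.2]
    rwa [sub_zero] at this
  constructor
  · have z : |∑ k ∈ I, m k * (coord v σ a b (x k) - (x k - σ))| ≤ W * (2 * B * R ^ 3) := by
      refine h.abs_sum_le (by positivity) fun k hk => ?_
      have h1 := hf.tan (x k)
      have h2 : |l * (x k - σ) ^ 3| ≤ B * R ^ 3 := by
        rw [abs_mul, abs_pow]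
        exact mul_le_mul hf.abs_l (pow_le_pow_left₀ (abs_nonneg _) (hR k hk) 3) (by positivity) hB
      have h3 : B * |x k - σ| ^ 4 ≤ B * R ^ 4 :=
        mul_le_mul_of_nonneg_left (pow_le_pow_left₀ (abs_nonneg _) (hR k hk) 4) hB
      have h4 : B * R ^ 4 ≤ B * R ^ 3 :=
        mul_le_mul_of_nonneg_left (pow_le_pow_of_le_one hR0 hR1 (by norm_num)) hB
      rw [abs_le] at *
      constructor <;> linarith [h1.1, h1.2, h2.1, h2.2]
    have e : ∑ k ∈ I, m k * coord v σ a b (x k) = ∑ k ∈ I, m k * (x k - σ) +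
        ∑ k ∈ I, m k * (coord v σ a b (x k) - (x k - σ)) := by
      rw [← Finset.sum_add_distrib]
      exact Finset.sum_congr rfl fun k _ => by ring
    rw [e]
    exact (abs_add_le _ _).trans (add_le_add y1 z)
  · have z : |∑ k ∈ I, m k * (coord v σ (-b) a (x k) -
        (κ * (x k - σ) ^ 2 + μ * (x k - σ) ^ 3))| ≤ W * (B * R ^ 4) := by
      refine h.abs_sum_le (by positivity) fun k hk => (hf.nor (x k)).trans ?_
      exact mul_le_mul_of_nonneg_left (pow_le_pow_left₀ (abs_nonneg _) (hR k hk) 4) hB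
    have e : ∑ k ∈ I, m k * coord v σ (-b) a (x k) = κ * ∑ k ∈ I, m k * (x k - σ) ^ 2 +
        μ * ∑ k ∈ I, m k * (x k - σ) ^ 3 + ∑ k ∈ I, m k * (coord v σ (-b) a (x k) -
        (κ * (x k - σ) ^ 2 + μ * (x k - σ) ^ 3)) := by
      rw [Finset.mul_sum, Finset.mul_sum, ← Finset.sum_add_distrib, ← Finset.sum_add_distrib]
      exact Finset.sum_congr rfl fun k _ => by ring
    rw [e]
    refine (abs_add_le _ _).trans (add_le_add ((abs_add_le _ _).trans (add_le_add ?_ ?_)) z)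
    · rw [abs_mul]
      exact mul_le_mul hf.abs_κ y2 (abs_nonneg _) hB
    · rw [abs_mul]
      exact mul_le_mul hf.abs_μ y3 (abs_nonneg _) hB

theorem CubicRow.sum_coord (h : CubicRow I m c W) (a b : ℝ) :
    ∑ k ∈ I, m k * coord v σ a b (x k) =
      a * (∑ k ∈ I, m k * (v (x k)).1 - (v σ).1) + b * (∑ k ∈ I, m k * (v (x k)).2 - (v σ).2) := by
  have : ∀ k, m k * coord v σ a b (x k) = a * (m k * (v (x k)).1) + b * (m k * (v (x k)).2) -
      (a * (v σ).1 + b * (v σ).2) * m k := fun k => by simp only [coord]; ring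
  simp only [this, Finset.sum_sub_distrib, Finset.sum_add_distrib, ← Finset.mul_sum, h.one]
  ring

/-- The rows of a finitely supported subdivision mask reproducing cubics are cubic rows on
uniformly bounded windows. -/
theorem exists_cubicRow {p : ℕ} {b : ℤ → ℝ} (hb : (Function.support b).Finite)
    (hrepT : ∀ 𝔭 : Polynomial ℝ, 𝔭.degree ≤ 3 → ∀ i : ℤ,
      (∑ᶠ k : ℤ, b (i - 2 * k) * 𝔭.eval (k : ℝ)) = 𝔭.eval ((i : ℝ) / 2 + ((p : ℝ) - 1) / 4))
    (N₁ : ℕ) : ∃ N : ℕ, N₁ ≤ N ∧ ∃ W : ℝ, ∀ K : ℤ,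
      CubicRow (Finset.Icc (K / 2 - N) (K / 2 + N)) (fun k => b (K - 2 * k)) (center p K) W ∧
      ∀ y : ℤ → ℝ × ℝ, ∑ᶠ k : ℤ, b (K - 2 * k) • y k =
        ∑ k ∈ Finset.Icc (K / 2 - N) (K / 2 + N), b (K - 2 * k) • y k := by
  obtain ⟨N₂, hN₂⟩ : ∃ N₂ : ℕ, ∀ i, b i ≠ 0 → |i| ≤ N₂ := by
    obtain ⟨M, hM⟩ := (hb.image fun i => i.natAbs).bddAbove
    exact ⟨M, fun i hi => by rw [Int.abs_eq_natAbs]; exact_mod_cast hM ⟨i, hi, rfl⟩⟩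
  obtain ⟨β, hβ⟩ : ∃ β, ∀ i, |b i| ≤ β := by
    obtain ⟨M, hM⟩ := (hb.image fun i => |b i|).bddAbove
    refine ⟨max M 0, fun i => ?_⟩
    by_cases hi : b i = 0
    · simp [hi]
    · exact (hM ⟨i, hi, rfl⟩).trans (le_max_left _ _)
  set N := max N₁ N₂
  have hsupp : ∀ K k : ℤ, b (K - 2 * k) ≠ 0 → k ∈ Finset.Icc (K / 2 - N : ℤ) (K / 2 + N) := by
    intro K k hk
    have h1 := abs_le.1 (hN₂ _ hk)
    have h2 : N₂ ≤ N := le_max_right _ _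
    rw [Finset.mem_Icc]
    constructor <;> omega
  refine ⟨N, le_max_left _ _, (2 * N + 1) * β, fun K => ⟨?_, fun y => ?_⟩⟩
  · have hm : ∀ n : ℕ, n ≤ 3 → ∑ k ∈ Finset.Icc (K / 2 - N : ℤ) (K / 2 + N),
        b (K - 2 * k) * ((k : ℝ) - center p K) ^ n = 0 ^ n := by
      intro n hn
      have h1 := hrepT ((Polynomial.X - Polynomial.C (center p K)) ^ n) (by
        refine (Polynomial.degree_pow_le_of_le n (Polynomial.degree_X_sub_C_le _)).trans ?_
        exact_mod_cast (by simpa using hn : n * 1 ≤ 3)) K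
      rw [finsum_eq_sum_of_support_subset (s := Finset.Icc (K / 2 - N : ℤ) (K / 2 + N))] at h1
      · simp only [Polynomial.eval_pow, Polynomial.eval_sub, Polynomial.eval_X,
          Polynomial.eval_C] at h1
        rw [h1, center, sub_self]
      · intro k hk
        exact hsupp K k (left_ne_zero_of_mul hk)
    refine ⟨by simpa using hm 0 (by norm_num), by simpa using hm 1 (by norm_num),
      by simpa using hm 2 (by norm_num), by simpa using hm 3 (by norm_num), ?_⟩
    refine (Finset.sum_le_card_nsmul _ _ β fun k _ => hβ _).trans (le_of_eq ?_)
    rw [Int.card_Icc, nsmul_eq_mul, show (K / 2 + N + 1 - (K / 2 - N) : ℤ) = ((2 * N + 1 : ℕ) : ℤ) by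
      push_cast; ring, Int.toNat_natCast]
    push_cast
    ring
  · refine finsum_eq_sum_of_support_subset _ fun k hk => hsupp K k fun h0 => hk ?_
    simp [h0]

end Prediction

section Global

theorem S_second_diff (p : ℕ) (x : ℤ → ℝ) (K : ℤ) :
    S (p + 2) x (K + 2) - 2 * S (p + 2) x (K + 1) + S (p + 2) x K =
      1 / 4 * S p (fun i => x (i + 2) - 2 * x (i + 1) + x i) K := by
  have h1 := S_succ_diff (p + 1) x (K + 1)
  have h2 := S_succ_diff (p + 1) x K
  have h3 := S_succ_diff p (fun i => x (i + 1) - x i) K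
  rw [show K + 1 + 1 = K + 2 by ring] at h1
  rw [show (fun i => x (i + 2) - 2 * x (i + 1) + x i) =
    fun i => x (i + 1 + 1) - x (i + 1) - (x (i + 1) - x i) by
      ext i; rw [show i + 1 + 1 = i + 2 by ring]; ring]
  linarith

theorem S_third_diff (p : ℕ) (x : ℤ → ℝ) (K : ℤ) :
    S (p + 3) x (K + 3) - 3 * S (p + 3) x (K + 2) + 3 * S (p + 3) x (K + 1) - S (p + 3) x K =
      1 / 8 * S p (fun i => x (i + 3) - 3 * x (i + 2) + 3 * x (i + 1) - x i) K := by
  have h1 := S_second_diff (p + 1) x (K + 1)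
  have h2 := S_second_diff (p + 1) x K
  have h3 := S_succ_diff p (fun i => x (i + 2) - 2 * x (i + 1) + x i) K
  rw [show K + 1 + 1 = K + 2 by ring, show K + 1 + 2 = K + 3 by ring] at h1
  rw [show (fun i => x (i + 3) - 3 * x (i + 2) + 3 * x (i + 1) - x i) =
    fun i => x (i + 1 + 2) - 2 * x (i + 1 + 1) + x (i + 1) - (x (i + 2) - 2 * x (i + 1) + x i) by
      ext i; rw [show i + 1 + 1 = i + 2 by ring, show i + 1 + 2 = i + 3 by ring]; ring]
  linarith

theorem second_diff_decay {p : ℕ} {s : ℕ → ℤ → ℝ} {C M : ℝ}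
    (h₀ : ∀ i, |s 0 (i + 1) - s 0 i| ≤ M)
    (he : ∀ j K, |S (p + 2) (s j) K - s (j + 1) K| ≤ C * (1 / 2) ^ (3 * j)) :
    ∃ C', ∀ j i, |s j (i + 2) - 2 * s j (i + 1) + s j i| ≤ C' * (1 / 4) ^ j := by
  refine decay_of_recurrence (y := fun j i => s j (i + 2) - 2 * s j (i + 1) + s j i)
    (C₀ := 2 * M) (C := 4 * C) (by norm_num) (fun i => ?_) fun j M hM i => ?_
  · have h1 := h₀ i
    have h2 := h₀ (i + 1)
    rw [show i + 1 + 1 = i + 2 by ring] at h2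
    rw [abs_le] at *
    constructor <;> linarith [h1.1, h1.2, h2.1, h2.2]
  · have e := S_second_diff p (s j) i
    have h1 := S_abs_le_const (p := p) (K := i) fun k _ _ => hM k
    have e0 := he j i
    have e1 := he j (i + 1)
    have e2 := he j (i + 2)
    have hp : (1 / 4 : ℝ) ^ j * (1 / 2) ^ j = (1 / 2) ^ (3 * j) := by
      rw [← mul_pow, pow_mul]; norm_num
    rw [mul_assoc, hp]
    rw [abs_le] at *
    constructor <;> linarith [h1.1, h1.2, e0.1, e0.2, e1.1, e1.2, e2.1, e2.2]

theorem third_diff_decay {p : ℕ} {s : ℕ → ℤ → ℝ} {C M : ℝ}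
    (h₀ : ∀ i, |s 0 (i + 1) - s 0 i| ≤ M)
    (he : ∀ j K, |S (p + 3) (s j) K - s (j + 1) K| ≤ C * (1 / 2) ^ (4 * j)) :
    ∃ C', ∀ j i,
      |s j (i + 3) - 3 * s j (i + 2) + 3 * s j (i + 1) - s j i| ≤ C' * (1 / 8) ^ j := by
  refine decay_of_recurrence
    (y := fun j i => s j (i + 3) - 3 * s j (i + 2) + 3 * s j (i + 1) - s j i)
    (C₀ := 4 * M) (C := 8 * C) (by norm_num) (fun i => ?_) fun j M hM i => ?_
  · have h1 := h₀ i
    have h2 := h₀ (i + 1)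
    have h3 := h₀ (i + 2)
    rw [show i + 1 + 1 = i + 2 by ring] at h2
    rw [show i + 2 + 1 = i + 3 by ring] at h3
    rw [abs_le] at *
    constructor <;> linarith [h1.1, h1.2, h2.1, h2.2, h3.1, h3.2]
  · have e := S_third_diff p (s j) i
    have h1 := S_abs_le_const (p := p) (K := i) fun k _ _ => hM k
    have e0 := he j i
    have e1 := he j (i + 1)
    have e2 := he j (i + 2)
    have e3 := he j (i + 3)
    have hp : (1 / 8 : ℝ) ^ j * (1 / 2) ^ j = (1 / 2) ^ (4 * j) := by
      rw [← mul_pow, pow_mul]; norm_num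
    rw [mul_assoc, hp]
    rw [abs_le] at *
    constructor <;> linarith [h1.1, h1.2, e0.1, e0.2, e1.1, e1.2, e2.1, e2.2, e3.1, e3.2]

theorem exists_forall_ge_mul_half_pow_le (c : ℝ) {ε : ℝ} (hε : 0 < ε) :
    ∃ J : ℕ, ∀ j, J ≤ j → c * (1 / 2) ^ j ≤ ε := by
  have h : Filter.Tendsto (fun j : ℕ => c * (1 / 2 : ℝ) ^ j) Filter.atTop (nhds (c * 0)) :=
    (tendsto_pow_atTop_nhds_zero_of_lt_one (by norm_num) (by norm_num)).const_mul c
  rw [mul_zero] at h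
  obtain ⟨J, hJ⟩ := Filter.eventually_atTop.1 (h.eventually (gt_mem_nhds hε))
  exact ⟨J, fun j hj => (hJ j hj).le⟩

/-- The properties of the parameters of a normal multiscale transform that govern their
asymptotic regularity. -/
structure NormalTransform (v : ℝ → ℝ × ℝ) (q : ℕ) (L : ℝ) (s : ℕ → ℤ → ℝ) : Prop where
  step_le : ∀ j i, |s j (i + 1) - s j i| ≤ L
  small : ∀ ε, 0 < ε → ∃ J, ∀ j, J ≤ j → ∀ i, |s j (i + 1) - s j i| ≤ ε
  step : ∀ j K M, (∀ i, |s j (i + 1) - s j i| ≤ M) →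
    NormalStep v q K (s j) (s (j + 1) K) ((q + 3) * M)

variable {v : ℝ → ℝ × ℝ} {q : ℕ} {L B : ℝ} {s : ℕ → ℤ → ℝ}

theorem S_sub_const (p : ℕ) (x : ℤ → ℝ) (σ : ℝ) (K : ℤ) :
    S p (fun i => x i - σ) K = S p x K - σ := by
  rw [S_sub, S_const]

theorem NormalTransform.abs_defect_le (h : NormalTransform v q L s) (j : ℕ) (K : ℤ) :
    |S (q + 2) (s j) K - s (j + 1) K| ≤ (q + 3) * L := by
  have := (h.step j K L (h.step_le j)).abs_S_pow_le 1
  simpa [S_sub_const] using this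

theorem NormalTransform.abs_defect_le_cube (h : NormalTransform v q L s)
    (hF : ∀ σ, ∃ a b l κ μ, FrenetExpansion v B σ a b l κ μ) {j : ℕ} {M : ℝ}
    (hM : ∀ i, |s j (i + 1) - s j i| ≤ M) (hr : B * ((q + 3) * M) ^ 2 ≤ 1 / 2)
    (hr1 : (q + 3) * M ≤ 1) (K : ℤ) :
    |S (q + 2) (s j) K - s (j + 1) K| ≤ (18 * B ^ 2 + 2 * B) * ((q + 3) * M) ^ 3 := by
  obtain ⟨a, b, l, κ, μ, hf⟩ := hF (s (j + 1) K)
  simpa only [S_sub_const] using (h.step j K M hM).abs_S_sub_le_cube hf hr hr1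

theorem NormalTransform.mesh_decay (h : NormalTransform v q L s) (hB : 1 ≤ B)
    (hF : ∀ σ, ∃ a b l κ μ, FrenetExpansion v B σ a b l κ μ) :
    ∃ C, 0 ≤ C ∧ ∀ j i, |s j (i + 1) - s j i| ≤ C * (1 / 2) ^ j := by
  set C := 2 * ((18 * B ^ 2 + 2 * B) * ((q : ℝ) + 3) ^ 3) with hCdef
  have hC : 0 ≤ C := by positivity
  set D := 1 + 8 * B * ((q : ℝ) + 3) ^ 2 + 2 * (q + 3) + 32 * C with hD
  have hD1 : 1 ≤ D := by
    have : 0 ≤ 8 * B * ((q : ℝ) + 3) ^ 2 + 2 * (q + 3) + 32 * C := by positivity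
    linarith
  have hD0 : 0 < D := by linarith
  set A := 1 / D with hA
  have hA0 : 0 < A := by positivity
  have hA1 : A ≤ 1 := by rw [hA, div_le_one hD0]; exact hD1
  have hAD : A * D = 1 := by rw [hA]; field_simp
  have hAA : A ^ 2 ≤ A := by nlinarith
  have hs1 : A * (8 * B * ((q : ℝ) + 3) ^ 2) ≤ 1 := by
    rw [← hAD]; gcongr; rw [hD]
    have : 0 ≤ 2 * ((q : ℝ) + 3) + 32 * C := by positivity
    linarith
  have hs2 : A * (2 * ((q : ℝ) + 3)) ≤ 1 := by
    rw [← hAD]; gcongr; rw [hD]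
    have : 0 ≤ 8 * B * ((q : ℝ) + 3) ^ 2 + 32 * C := by positivity
    linarith
  have hs3 : A * (32 * C) ≤ 1 := by
    rw [← hAD]; gcongr; rw [hD]
    have : 0 ≤ 8 * B * ((q : ℝ) + 3) ^ 2 + 2 * (q + 3) := by positivity
    linarith
  obtain ⟨J, hJ⟩ := h.small A hA0
  have key : ∀ j i, |s (J + j) (i + 1) - s (J + j) i| ≤ A * (1 / 2) ^ j * (2 - (1 / 2) ^ j) := by
    refine geometric_of_cubic_perturbation (C := C) hA0.le hC (by nlinarith) (hJ J le_rfl)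
      fun j M hM0 hM hMs i => ?_
    have hr1 : ((q : ℝ) + 3) * M ≤ 1 := by
      have : ((q : ℝ) + 3) * M ≤ (q + 3) * (2 * A) := by gcongr
      linarith
    have hr : B * (((q : ℝ) + 3) * M) ^ 2 ≤ 1 / 2 := by
      have h1 : B * (((q : ℝ) + 3) * M) ^ 2 ≤ B * ((q + 3) * (2 * A)) ^ 2 := by gcongr
      have h2 : A ^ 2 * (8 * B * ((q : ℝ) + 3) ^ 2) ≤ A * (8 * B * ((q : ℝ) + 3) ^ 2) := by gcongr
      nlinarith
    have e1 := h.abs_defect_le_cube hF hMs hr hr1 i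
    have e2 := h.abs_defect_le_cube hF hMs hr hr1 (i + 1)
    have e3 := S_succ_diff (q + 1) (s (J + j)) i
    have e4 := S_abs_le_const (p := q + 1) (K := i) fun k _ _ => hMs k
    have e5 : C * M ^ 3 = 2 * ((18 * B ^ 2 + 2 * B) * (((q : ℝ) + 3) * M) ^ 3) := by
      rw [hCdef]; ring
    rw [e5]
    rw [show J + (j + 1) = J + j + 1 by ring]
    rw [abs_le] at *
    constructor <;> linarith [e1.1, e1.2, e2.1, e2.2, e4.1, e4.2]
  have := decay_of_eventually (y := fun j i => s j (i + 1) - s j i) (m := 1) (J := J)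
    (C := 2 * A * 2 ^ J) h.step_le fun j hj i => by
      obtain ⟨n, rfl⟩ := Nat.exists_eq_add_of_le hj
      refine (key n i).trans ?_
      have h1 : (0 : ℝ) ≤ (1 / 2) ^ n := by positivity
      have h2 : (2 : ℝ) * A * 2 ^ J * (1 / 2) ^ (1 * (J + n)) = A * (1 / 2) ^ n * 2 := by
        rw [one_mul, pow_add, one_div_pow, one_div_pow]
        field_simp
      rw [h2]
      gcongr
      linarith
  simpa only [one_mul] using this

theorem NormalTransform.defect_decay_three (h : NormalTransform v q L s) (hB : 1 ≤ B)
    (hF : ∀ σ, ∃ a b l κ μ, FrenetExpansion v B σ a b l κ μ) :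
    ∃ C, 0 ≤ C ∧ ∀ j K, |S (q + 2) (s j) K - s (j + 1) K| ≤ C * (1 / 2) ^ (3 * j) := by
  obtain ⟨C₁, hC₁, hs⟩ := h.mesh_decay hB hF
  obtain ⟨J, hJ⟩ := exists_forall_ge_mul_half_pow_le ((q + 3) * C₁)
    (ε := 1 / (2 * B)) (by positivity)
  refine decay_of_eventually (J := J) (C := (18 * B ^ 2 + 2 * B) * (((q : ℝ) + 3) * C₁) ^ 3)
    h.abs_defect_le fun j hj K => ?_
  have hr := hJ j hj
  rw [mul_assoc] at hr
  have hr0 : 0 ≤ ((q : ℝ) + 3) * (C₁ * (1 / 2) ^ j) := by positivity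
  have hB' : 1 / (2 * B) ≤ 1 / 2 := by
    rw [div_le_div_iff₀ (by positivity) (by norm_num)]; linarith
  refine (h.abs_defect_le_cube hF (hs j) ?_ (by linarith) K).trans (le_of_eq ?_)
  · have h1 : B * (((q : ℝ) + 3) * (C₁ * (1 / 2) ^ j)) ≤ 1 / 2 := by
      calc _ ≤ B * (1 / (2 * B)) := by gcongr
        _ = 1 / 2 := by field_simp
    nlinarith
  · rw [mul_comm 3 j, pow_mul]
    ring

end Global

section Regularity

variable {v : ℝ → ℝ × ℝ} {q : ℕ} {L B : ℝ} {s : ℕ → ℤ → ℝ}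

theorem NormalTransform.second_diff_decay (h : NormalTransform v q L s) (hB : 1 ≤ B)
    (hF : ∀ σ, ∃ a b l κ μ, FrenetExpansion v B σ a b l κ μ) :
    ∃ C, 0 ≤ C ∧ ∀ j i, |s j (i + 2) - 2 * s j (i + 1) + s j i| ≤ C * ((1 / 2) ^ j) ^ 2 := by
  obtain ⟨C₀, -, hC₀⟩ := h.defect_decay_three hB hF
  obtain ⟨C, hC⟩ := _root_.second_diff_decay (h.step_le 0) hC₀
  refine ⟨C, ?_, fun j i => ?_⟩
  · have := (abs_nonneg _).trans (hC 0 0)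
    simpa using this
  · have := hC j i
    rwa [← pow_mul, mul_comm j, pow_mul, show ((1 : ℝ) / 2) ^ 2 = 1 / 4 by norm_num]

theorem NormalTransform.defect_decay_four (h : NormalTransform v q L s) (hB : 1 ≤ B) (hq : 1 ≤ q)
    (hF : ∀ σ, ∃ a b l κ μ, FrenetExpansion v B σ a b l κ μ) :
    ∃ C, 0 ≤ C ∧ ∀ j K, |S (q + 2) (s j) K - s (j + 1) K| ≤ C * (1 / 2) ^ (4 * j) := by
  obtain ⟨C₀, hC₀, he⟩ := h.defect_decay_three hB hF
  obtain ⟨C₁, hC₁, hs⟩ := h.mesh_decay hB hF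
  obtain ⟨C₂, hC₂, hs2⟩ := h.second_diff_decay hB hF
  obtain ⟨J, hJ⟩ := exists_forall_ge_mul_half_pow_le ((q + 3) * C₁)
    (ε := 1 / (2 * B)) (by positivity)
  set N := q + 3 with hN
  set F := C₀ + 2 * N ^ 2 * C₂
  set c := ((q : ℝ) + 3) * C₁ with hc
  set R := c + C₁ * (2 * N) with hR
  refine decay_of_eventually (J := J) (C := 6 * B * c ^ 2 * (B * ((16 * N + 2) * F) + B * c ^ 2) +
    B * c ^ 4 + B * (3 * R ^ 2 * F)) h.abs_defect_le fun j hj K => ?_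
  have hr := hJ j hj
  have he' := he j K
  have hs' := hs j
  have hs2' := hs2 j
  rw [mul_comm 3 j, pow_mul] at he'
  rw [mul_comm 4 j, pow_mul]
  have hρ0 : (0 : ℝ) ≤ (1 / 2) ^ j := by positivity
  have hρ1 : ((1 : ℝ) / 2) ^ j ≤ 1 := pow_le_one₀ (by norm_num) (by norm_num)
  set ρ : ℝ := (1 / 2) ^ j
  have hc0 : 0 ≤ c := by positivity
  have hr0 : 0 ≤ c * ρ := by positivity
  have hB' : 1 / (2 * B) ≤ 1 / 2 := by
    rw [div_le_div_iff₀ (by positivity) (by norm_num)]; linarith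
  have hBr : B * (c * ρ) ^ 2 ≤ 1 / 2 := by
    have h1 : B * (c * ρ) ≤ 1 / 2 := by
      calc _ ≤ B * (1 / (2 * B)) := by gcongr
        _ = 1 / 2 := by field_simp
    nlinarith
  have hstep : NormalStep v q K (s j) (s (j + 1) K) (c * ρ) := by
    rw [hc, mul_assoc]; exact h.step j K _ hs'
  obtain ⟨a, b, l, κ, μ, hf⟩ := hF (s (j + 1) K)
  have he3 : |S (q + 2) (fun i => s j i - s (j + 1) K) K| ≤ C₀ * ρ ^ 2 := by
    rw [S_sub_const]
    refine he'.trans ?_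
    exact mul_le_mul_of_nonneg_left (pow_le_pow_of_le_one hρ0 hρ1 (by norm_num)) hC₀
  have hE : ∀ i : ℤ, |i - K / 2| ≤ N →
      |s j i - s (j + 1) K - (s j (K / 2 + 1) - s j (K / 2)) * (i - center (q + 2) K)| ≤
        F * ρ ^ 2 := fun i hi =>
    (abs_sub_affine_center_le (by omega) (by omega) he3 hs2' hi).trans (le_of_eq (by ring))
  have hdR : |s j (K / 2 + 1) - s j (K / 2)| * (2 * N) ≤ R * ρ := by
    have : |s j (K / 2 + 1) - s j (K / 2)| * (2 * N) ≤ C₁ * ρ * (2 * N) := by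
      gcongr; exact hs' _
    rw [hR, add_mul]
    linarith
  have key := hstep.abs_S_sub_le_of_affine hf hBr (by linarith) hq (by omega) hE
    (R := R * ρ) (by rw [hR]; gcongr; linarith [show 0 ≤ C₁ * (2 * N) by positivity]) hdR
  rw [S_sub_const] at key
  exact key.trans (le_of_eq (by ring))

theorem NormalTransform.third_diff_decay (h : NormalTransform v q L s) (hB : 1 ≤ B) (hq : 1 ≤ q)
    (hF : ∀ σ, ∃ a b l κ μ, FrenetExpansion v B σ a b l κ μ) :
    ∃ C, 0 ≤ C ∧ ∀ j i,
      |s j (i + 3) - 3 * s j (i + 2) + 3 * s j (i + 1) - s j i| ≤ C * ((1 / 2) ^ j) ^ 3 := by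
  obtain ⟨C₀, -, hC₀⟩ := h.defect_decay_four hB hq hF
  obtain ⟨k, rfl⟩ := Nat.exists_eq_add_of_le' hq
  obtain ⟨C, hC⟩ := _root_.third_diff_decay (p := k) (h.step_le 0) hC₀
  refine ⟨C, ?_, fun j i => ?_⟩
  · have := (abs_nonneg _).trans (hC 0 0)
    simpa using this
  · have := hC j i
    rwa [← pow_mul, mul_comm j, pow_mul, show ((1 : ℝ) / 2) ^ 3 = 1 / 8 by norm_num]

/-- The detail estimate at a single level: if the parameters are regular up to third order, then a
cubic prediction row has normal defect of fourth order in the mesh `ρ`. -/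
theorem exists_abs_detail_le (q N : ℕ) (hq : 1 ≤ q) (hN : q + 3 ≤ N) {B c C₀ C₁ C₂ C₃ W : ℝ}
    (hB : 0 ≤ B) (hC₀ : 0 ≤ C₀) (hC₁ : 0 ≤ C₁) (hC₂ : 0 ≤ C₂) (hC₃ : 0 ≤ C₃) (hW : 0 ≤ W) :
    ∃ C R : ℝ, ∀ (v : ℝ → ℝ × ℝ) (x : ℤ → ℝ) (m : ℤ → ℝ) (K : ℤ) (σ ρ a b l κ μ : ℝ),
      0 ≤ ρ → ρ ≤ 1 → R * ρ ≤ 1 → B * (c * ρ) ^ 2 ≤ 1 / 2 →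
      FrenetExpansion v B σ a b l κ μ → NormalStep v q K x σ (c * ρ) →
      CubicRow (Finset.Icc (K / 2 - N) (K / 2 + N)) m (center (q + 2) K) W →
      |S (q + 2) (fun i => x i - σ) K| ≤ C₀ * ρ ^ 3 →
      (∀ i, |x (i + 1) - x i| ≤ C₁ * ρ) →
      (∀ i, |x (i + 2) - 2 * x (i + 1) + x i| ≤ C₂ * ρ ^ 2) →
      (∀ i, |x (i + 3) - 3 * x (i + 2) + 3 * x (i + 1) - x i| ≤ C₃ * ρ ^ 3) →
      |dot (v σ - ∑ k ∈ Finset.Icc (K / 2 - N : ℤ) (K / 2 + N), m k • v (x k))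
        ((enorm2 (S q (Δ fun k => v (x k)) K))⁻¹ • perp (S q (Δ fun k => v (x k)) K))| ≤
        C * ρ ^ 4 := by
  obtain ⟨F, hF⟩ : ∃ t, t = C₀ + N * C₂ + N ^ 3 * C₃ + 4 * N ^ 2 * C₂ := ⟨_, rfl⟩
  obtain ⟨G, hG⟩ : ∃ t, t = (N : ℝ) ^ 3 * C₃ := ⟨_, rfl⟩
  obtain ⟨d₀, hd₀⟩ : ∃ t, t = C₁ + (N + 1) * C₂ := ⟨_, rfl⟩
  obtain ⟨R, hR⟩ : ∃ t, t = 2 * N * d₀ + F + G := ⟨_, rfl⟩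
  obtain ⟨ω, hω⟩ : ∃ t, t = 2 * (B * ((16 * N + 2) * (F + G)) + B * c ^ 2) := ⟨_, rfl⟩
  have hF0 : 0 ≤ F := by rw [hF]; positivity
  have hG0 : 0 ≤ G := by rw [hG]; positivity
  have hd₀0 : 0 ≤ d₀ := by rw [hd₀]; positivity
  have hFα : C₀ + N * C₂ + N ^ 3 * C₃ ≤ F := by
    rw [hF]
    linarith [show 0 ≤ 4 * (N : ℝ) ^ 2 * C₂ by positivity]
  have hR0 : 0 ≤ R := by rw [hR]; positivity
  have hω0 : 0 ≤ ω := by rw [hω]; positivity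
  refine ⟨B * (F ^ 2 + W * (F ^ 2 + 2 * R * G)) + B * (W * (3 * R ^ 2 * (F + G))) +
    W * (B * R ^ 4) + (F + W * G + W * (2 * B * R ^ 3)) * ω, R, ?_⟩
  intro v x m K σ ρ a b l κ μ hρ0 hρ1 hRρ hBr hf hstep hrow h₀ h₁ h₂ h₃
  have p32 : ρ ^ 3 ≤ ρ ^ 2 := pow_le_pow_of_le_one hρ0 hρ1 (by norm_num)
  have p21 : ρ ^ 2 ≤ ρ := by nlinarith
  obtain ⟨α, d, β, hα, hd, hβ, hx⟩ :=
    exists_quadratic_center (N := N) (p := q + 2) (by omega) (by omega) h₀ h₁ h₂ h₃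
  have hα' : |α| ≤ (C₀ + N * C₂ + N ^ 3 * C₃) * ρ ^ 2 := by
    refine hα.trans ?_
    have e1 : C₀ * ρ ^ 3 ≤ C₀ * ρ ^ 2 := by gcongr
    have e2 : (N : ℝ) ^ 3 * (C₃ * ρ ^ 3) ≤ N ^ 3 * (C₃ * ρ ^ 2) := by gcongr
    linarith
  have hd' : |d| ≤ d₀ * ρ := by
    refine hd.trans ?_
    have : ((N : ℝ) + 1) * (C₂ * ρ ^ 2) ≤ (N + 1) * (C₂ * ρ) := by gcongr
    rw [hd₀]
    linarith
  have hwin : ∀ k ∈ Finset.Icc (K / 2 - N : ℤ) (K / 2 + N), |k - K / 2| ≤ N := fun k hk => by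
    rw [Finset.mem_Icc] at hk
    rw [abs_le]
    constructor <;> omega
  have hkc : ∀ k : ℤ, |k - K / 2| ≤ N → |(k : ℝ) - center (q + 2) K| ≤ 2 * N := fun k hk =>
    abs_sub_center_le (by omega) (by omega) hk
  have hx' : ∀ i : ℤ, |i - K / 2| ≤ N → |x i - σ - (α + d * (i - center (q + 2) K) +
      β * (i - center (q + 2) K) ^ 2)| ≤ G * ρ ^ 3 := fun i hi =>
    (hx i hi).trans (le_of_eq (by rw [hG]; ring))
  have hαβ : ∀ k : ℤ, |k - K / 2| ≤ N → |α + β * ((k : ℝ) - center (q + 2) K) ^ 2| ≤ F * ρ ^ 2 := by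
    intro k hk
    have e1 : |β * ((k : ℝ) - center (q + 2) K) ^ 2| ≤ C₂ * ρ ^ 2 * (2 * N) ^ 2 := by
      rw [abs_mul, abs_pow]
      have := hkc k hk
      gcongr
    refine (abs_add_le _ _).trans ?_
    rw [hF]
    linarith
  have hdk : ∀ k : ℤ, |k - K / 2| ≤ N → |d * ((k : ℝ) - center (q + 2) K)| ≤ 2 * N * d₀ * ρ := by
    intro k hk
    rw [abs_mul]
    calc _ ≤ d₀ * ρ * (2 * N) := by
          have := hkc k hk
          gcongr
      _ = _ := by ring
  have hu : ∀ k : ℤ, |k - K / 2| ≤ N → |α + d * ((k : ℝ) - center (q + 2) K) +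
      β * ((k : ℝ) - center (q + 2) K) ^ 2| ≤ (2 * N * d₀ + F) * ρ := by
    intro k hk
    have e1 := hαβ k hk
    have e2 := hdk k hk
    have e3 : F * ρ ^ 2 ≤ F * ρ := by gcongr
    rw [abs_le] at *
    constructor <;> linarith [e1.1, e1.2, e2.1, e2.2]
  have hxR : ∀ k : ℤ, |k - K / 2| ≤ N → |x k - σ| ≤ R * ρ := by
    intro k hk
    have e1 := hu k hk
    have e2 := hx' k hk
    have e3 : G * ρ ^ 3 ≤ G * ρ := by gcongr; exact p32.trans p21
    rw [hR]
    rw [abs_le] at *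
    constructor <;> linarith [e1.1, e1.2, e2.1, e2.2]
  have hGρ : 0 ≤ G * ρ := by positivity
  have hFρ : 0 ≤ F * ρ := by positivity
  obtain ⟨ht, hn⟩ := hrow.coord_le hf hRρ (fun k hk => hxR k (hwin k hk))
    (hα'.trans (mul_le_mul_of_nonneg_right hFα (by positivity)))
    (fun k hk => hαβ k (hwin k hk))
    (fun k hk => (hdk k (hwin k hk)).trans (by rw [hR]; linarith))
    (fun k hk => (hu k (hwin k hk)).trans (by rw [hR]; linarith))
    (fun k hk => hx' k (hwin k hk)) (by positivity) (by positivity)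
  have hE : ∀ i : ℤ, |i - K / 2| ≤ N →
      |x i - σ - d * (i - center (q + 2) K)| ≤ (F + G) * ρ ^ 2 := by
    intro i hi
    have e1 := hαβ i hi
    have e2 := hx' i hi
    have e3 : G * ρ ^ 3 ≤ G * ρ ^ 2 := by gcongr
    rw [abs_le] at *
    constructor <;> linarith [e1.1, e1.2, e2.1, e2.2]
  have hWn := hstep.normal_le hf (S_diff_sq_le hstep.mono hq hN hE)
  obtain ⟨hD, hWt, -⟩ := hstep.tangent_estimates hf
  set D := S q (fun i => x (i + 1) - x i) K
  have hWt2 : D ≤ 2 * S q (fun i => coord v σ a b (x (i + 1)) - coord v σ a b (x i)) K := by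
    have : B * (c * ρ) ^ 2 * D ≤ 1 / 2 * D := by gcongr
    linarith [(abs_le.1 hWt).1]
  have ew : ∀ a b : ℝ, a * (S q (Δ fun k => v (x k)) K).1 + b * (S q (Δ fun k => v (x k)) K).2 =
      S q (fun i => coord v σ a b (x (i + 1)) - coord v σ a b (x i)) K := fun a b => by
    rw [S_diff_coord, S_fst, S_snd]
    rfl
  have eu : ∀ a b : ℝ,
      |a * (v σ - ∑ k ∈ Finset.Icc (K / 2 - N : ℤ) (K / 2 + N), m k • v (x k)).1 +
        b * (v σ - ∑ k ∈ Finset.Icc (K / 2 - N : ℤ) (K / 2 + N), m k • v (x k)).2| =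
      |∑ k ∈ Finset.Icc (K / 2 - N : ℤ) (K / 2 + N), m k * coord v σ a b (x k)| := fun a b => by
    rw [hrow.sum_coord, ← abs_neg]
    congr 1
    simp only [Prod.fst_sub, Prod.snd_sub, Prod.fst_sum, Prod.snd_sum, Prod.smul_fst,
      Prod.smul_snd, smul_eq_mul]
    ring
  have key := abs_dot_perp_le (ω := ω * ρ ^ 2)
    (u := v σ - ∑ k ∈ Finset.Icc (K / 2 - N : ℤ) (K / 2 + N), m k • v (x k))
    (w := S q (Δ fun k => v (x k)) K) hf.unit (by rw [ew]; linarith) (by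
      rw [ew, ew]
      refine hWn.trans ?_
      rw [show B * ((16 * N + 2) * ((F + G) * ρ ^ 2)) + B * (c * ρ) ^ 2 = ω * ρ ^ 2 / 2 by
        rw [hω]; ring]
      have : ω * ρ ^ 2 * D ≤ ω * ρ ^ 2 *
        (2 * S q (fun i => coord v σ a b (x (i + 1)) - coord v σ a b (x i)) K) := by gcongr
      linarith)
  rw [eu, eu] at key
  refine key.trans ?_
  have e1 : F * ρ ^ 2 + W * (G * ρ ^ 3) + W * (2 * B * (R * ρ) ^ 3) ≤
      (F + W * G + W * (2 * B * R ^ 3)) * ρ ^ 2 := by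
    have i1 : W * (G * ρ ^ 3) ≤ W * (G * ρ ^ 2) := by gcongr
    have i2 : W * (2 * B * R ^ 3) * ρ ^ 3 ≤ W * (2 * B * R ^ 3) * ρ ^ 2 := by gcongr
    linarith
  have e2 := mul_le_mul_of_nonneg_right (ht.trans e1) (show 0 ≤ ω * ρ ^ 2 by positivity)
  have e3 : B * (W * (3 * (R * ρ) ^ 2 * (F * ρ ^ 2 + G * ρ ^ 3))) ≤
      B * (W * (3 * R ^ 2 * (F + G))) * ρ ^ 4 := by
    have i1 : F * ρ ^ 2 + G * ρ ^ 3 ≤ (F + G) * ρ ^ 2 := by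
      have : G * ρ ^ 3 ≤ G * ρ ^ 2 := by gcongr
      linarith
    calc _ ≤ B * (W * (3 * (R * ρ) ^ 2 * ((F + G) * ρ ^ 2))) := by gcongr
      _ = _ := by ring
  linarith

end Regularity

section Transform

theorem abs_dot_perp_le_add (u w : ℝ × ℝ) :
    |dot u ((enorm2 w)⁻¹ • perp w)| ≤ |u.1| + |u.2| := by
  have h1 : |w.1| ≤ enorm2 w := Real.abs_le_sqrt (by nlinarith [sq_nonneg w.2])
  have h2 : |w.2| ≤ enorm2 w := Real.abs_le_sqrt (by nlinarith [sq_nonneg w.1])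
  have h0 : 0 ≤ enorm2 w := Real.sqrt_nonneg _
  have bound : ∀ t, |t| ≤ enorm2 w → |(enorm2 w)⁻¹ * t| ≤ 1 := fun t ht => by
    rw [abs_mul, abs_inv, abs_of_nonneg h0]
    exact inv_mul_le_one_of_le₀ ht h0
  simp only [dot, perp, Prod.smul_fst, Prod.smul_snd, smul_eq_mul]
  refine (abs_add_le _ _).trans (add_le_add ?_ ?_)
  · rw [abs_mul]
    exact mul_le_of_le_one_right (abs_nonneg _) (bound _ (by rwa [abs_neg]))
  · rw [abs_mul]
    exact mul_le_of_le_one_right (abs_nonneg _) (bound _ h1)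

theorem abs_detail_le_const {v : ℝ → ℝ × ℝ} {B W c : ℝ} {I : Finset ℤ} {m x : ℤ → ℝ}
    (hv : ∀ t, |(v t).1| ≤ B ∧ |(v t).2| ≤ B) (h : CubicRow I m c W) (σ : ℝ) (w : ℝ × ℝ) :
    |dot (v σ - ∑ k ∈ I, m k • v (x k)) ((enorm2 w)⁻¹ • perp w)| ≤ 2 * (B + W * B) := by
  have hB : 0 ≤ B := (abs_nonneg _).trans (hv 0).1
  refine (abs_dot_perp_le_add _ _).trans ?_
  simp only [Prod.fst_sub, Prod.snd_sub, Prod.fst_sum, Prod.snd_sum, Prod.smul_fst,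
    Prod.smul_snd, smul_eq_mul]
  have h1 := h.abs_sum_le hB fun k _ => (hv (x k)).1
  have h2 := h.abs_sum_le hB fun k _ => (hv (x k)).2
  have h3 := abs_sub (v σ).1 (∑ k ∈ I, m k * (v (x k)).1)
  have h4 := abs_sub (v σ).2 (∑ k ∈ I, m k * (v (x k)).2)
  linarith [(hv σ).1, (hv σ).2]

variable {v : ℝ → ℝ × ℝ} {L B : ℝ} {q N₀ : ℕ} {s : ℕ → ℤ → ℝ} {d : ℕ → ℤ → ℝ}

theorem normalTransform_of_data (hN₀ : 1 ≤ N₀) (hmono : ∀ j, StrictMono (s j))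
    (hsper : ∀ (j : ℕ) (i : ℤ), s j (i + N₀ * 2 ^ j) = s j i + L)
    (hdata : ∀ j : ℕ, 1 ≤ j → ∀ K : ℤ,
      v (s j K) = S (q + 2) (fun k => v (s (j - 1) k)) K +
        (d j K / enorm2 (S q (Δ fun k => v (s (j - 1) k)) K)) •
          perp (S q (Δ fun k => v (s (j - 1) k)) K))
    (hloc : ∀ j : ℕ, 1 ≤ j → ∀ i K : ℤ, 2 * i ≤ K → K ≤ 2 * i + (q + 2 : ℕ) + 2 →
      s (j - 1) i ≤ s j K ∧ s j K ≤ s (j - 1) (i + (q + 2 : ℕ) + 1))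
    {slim : ℝ → ℝ} (hconv : ∀ A : Set ℝ, IsCompact A →
      TendstoUniformlyOn (fun j => plin j (s j)) slim Filter.atTop A) :
    NormalTransform v q L s := by
  have habs : ∀ j i, |s j (i + 1) - s j i| = s j (i + 1) - s j i := fun j i =>
    abs_of_pos (sub_pos.2 (hmono j (lt_add_one i)))
  refine ⟨fun j i => ?_, fun ε hε => ?_, fun j K M hM => ⟨hmono j, fun i h1 h2 => ?_, ?_⟩⟩
  · rw [habs]
    refine step_le_period (n := N₀ * 2 ^ j) (Nat.succ_le_of_lt (by positivity)) (hmono j) ?_ i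
    intro i
    push_cast
    exact hsper j i
  · simpa only [habs] using exists_mesh_le hN₀ hmono hsper hconv hε
  · obtain ⟨l1, l2⟩ := hloc (j + 1) (by omega) (K / 2) K (by omega) (by push_cast; omega)
    rw [Nat.add_sub_cancel] at l1 l2
    have m1 : s j (K / 2) ≤ s j i := (hmono j).monotone (by omega)
    have m2 : s j i ≤ s j (K / 2 + (q + 2 : ℕ) + 1) :=
      (hmono j).monotone (by push_cast at h2 ⊢; omega)
    have m3 := abs_sub_le_of_step (z := s j) (i₀ := K / 2) (N := q + 3) (M := M)
      (fun i _ => hM i) (K / 2 + (q + 2 : ℕ) + 1)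
      (by rw [show K / 2 + (q + 2 : ℕ) + 1 - K / 2 = ((q + 3 : ℕ) : ℤ) by push_cast; ring]
          exact (abs_of_nonneg (by positivity)).le)
    push_cast at m2 m3 l2
    rw [abs_le] at *
    constructor <;> linarith [m3.2]
  · have e := hdata (j + 1) (by omega) K
    rw [Nat.add_sub_cancel] at e
    have e1 := congrArg Prod.fst e
    have e2 := congrArg Prod.snd e
    simp only [Prod.fst_add, Prod.snd_add, Prod.smul_fst, Prod.smul_snd, perp, smul_eq_mul] at e1 e2
    rw [S_fst] at e1
    rw [S_snd] at e2
    have w1 : (S q (Δ fun k => v (s j k)) K).1 = S q (fun i => (v (s j (i + 1))).1 - (v (s j i)).1) K :=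
      S_fst _ _ _
    have w2 : (S q (Δ fun k => v (s j k)) K).2 = S q (fun i => (v (s j (i + 1))).2 - (v (s j i)).2) K :=
      S_snd _ _ _
    rw [e1, e2, w1, w2]
    ring

end Transform

/-- Theorem 4.1: for `p ≥ 3`, a strictly convex simple closed `C⁴` arc-length curve, and a
linear subdivision operator `T` (finitely supported mask) reproducing cubics with shift
`(p−1)/4`, the combined `(S_p, S_{p−2}, T)` normal multiscale transform has detail decay
rate 4: `‖d̃^j‖ ≤ C·2^{−4j}`. -/
theorem combined_normal_MT_detail_decay (p : ℕ) (hp : 3 ≤ p)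
    (L : ℝ) (hL : 0 < L) (v : ℝ → ℝ × ℝ) (hper : ∀ t, v (t + L) = v t)
    (hreg : ContDiff ℝ 4 v) (hunit : ∀ t, dot (deriv v t) (deriv v t) = 1)
    (hsimple : Set.InjOn v (Set.Ico 0 L))
    (hconvex : ∀ t, 0 < curv v t)
    (N₀ : ℕ) (hN₀ : (p + 1) / 2 + 1 ≤ N₀)
    (s : ℕ → ℤ → ℝ) (hmono : ∀ j, StrictMono (s j))
    (hsper : ∀ (j : ℕ) (i : ℤ), s j (i + N₀ * 2 ^ j) = s j i + L)
    (d : ℕ → ℤ → ℝ)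
    (hdata : ∀ j : ℕ, 1 ≤ j → ∀ K : ℤ,
      S (p - 2) (Δ fun k => v (s (j - 1) k)) K ≠ 0 ∧
      v (s j K) = S p (fun k => v (s (j - 1) k)) K +
        (d j K / enorm2 (S (p - 2) (Δ fun k => v (s (j - 1) k)) K)) •
          perp (S (p - 2) (Δ fun k => v (s (j - 1) k)) K))
    (hloc : ∀ j : ℕ, 1 ≤ j → ∀ i K : ℤ, 2 * i ≤ K → K ≤ 2 * i + p + 2 →
      s (j - 1) i ≤ s j K ∧ s j K ≤ s (j - 1) (i + p + 1))
    (slim : ℝ → ℝ)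
    (hconv : ∀ A : Set ℝ, IsCompact A →
      TendstoUniformlyOn (fun j => plin j (s j)) slim Filter.atTop A)
    (b : ℤ → ℝ) (hb : (Function.support b).Finite)
    (hrepT : ∀ 𝔭 : Polynomial ℝ, 𝔭.degree ≤ 3 → ∀ i : ℤ,
      (∑ᶠ k : ℤ, b (i - 2 * k) * 𝔭.eval (k : ℝ)) = 𝔭.eval ((i : ℝ) / 2 + ((p : ℝ) - 1) / 4)) :
    ∃ C : ℝ, ∀ j : ℕ, 1 ≤ j → ∀ K : ℤ,
      |dot (v (s j K) - ∑ᶠ k : ℤ, b (K - 2 * k) • v (s (j - 1) k))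
          ((enorm2 (S (p - 2) (Δ fun k => v (s (j - 1) k)) K))⁻¹ •
            perp (S (p - 2) (Δ fun k => v (s (j - 1) k)) K))|
        ≤ C * (1 / 2 : ℝ) ^ (4 * j) := by
  obtain ⟨q, rfl⟩ : ∃ q, p = q + 2 := ⟨p - 2, by omega⟩
  rw [Nat.add_sub_cancel] at hdata ⊢
  have hq : 1 ≤ q := by omega
  obtain ⟨B, hB, hv, hF⟩ := exists_frenetExpansion hL hper hreg hunit
  have h : NormalTransform v q L s := normalTransform_of_data (by omega) hmono hsper
    (fun j hj K => (hdata j hj K).2) hloc hconv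
  obtain ⟨C₀, hC₀, he⟩ := h.defect_decay_three hB hF
  obtain ⟨C₁, hC₁, h₁⟩ := h.mesh_decay hB hF
  obtain ⟨C₂, hC₂, h₂⟩ := h.second_diff_decay hB hF
  obtain ⟨C₃, hC₃, h₃⟩ := h.third_diff_decay hB hq hF
  obtain ⟨N, hN, W, hT⟩ := exists_cubicRow hb hrepT (q + 3)
  set c := ((q : ℝ) + 3) * C₁ with hc
  have hc0 : 0 ≤ c := by positivity
  obtain ⟨C, R, key⟩ := exists_abs_detail_le q N hq hN (c := c) (by linarith : 0 ≤ B) hC₀ hC₁ hC₂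
    hC₃ (hT 0).1.W_nonneg
  obtain ⟨J₁, hJ₁⟩ := exists_forall_ge_mul_half_pow_le R one_pos
  obtain ⟨J₂, hJ₂⟩ := exists_forall_ge_mul_half_pow_le c (ε := 1 / (2 * B)) (by positivity)
  obtain ⟨C', -, hC'⟩ := decay_of_eventually (m := 4) (J := max J₁ J₂) (M := 2 * (B + W * B)) (C := C)
    (y := fun j K => dot (v (s (j + 1) K) - ∑ᶠ k : ℤ, b (K - 2 * k) • v (s j k))
      ((enorm2 (S q (Δ fun k => v (s j k)) K))⁻¹ • perp (S q (Δ fun k => v (s j k)) K)))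
    (fun j K => by
      simp only [(hT K).2]
      exact abs_detail_le_const hv (hT K).1 _ _)
    (fun j hj K => by
      obtain ⟨a, b', l, κ, μ, hf⟩ := hF (s (j + 1) K)
      have hr := hJ₂ j ((le_max_right _ _).trans hj)
      have hρ : (0 : ℝ) ≤ (1 / 2) ^ j := by positivity
      have hBr : B * (c * (1 / 2) ^ j) ^ 2 ≤ 1 / 2 := by
        have h1 : B * (c * (1 / 2) ^ j) ≤ 1 / 2 := by
          calc _ ≤ B * (1 / (2 * B)) := by gcongr
            _ = 1 / 2 := by field_simp
        have h2 : 1 / (2 * B) ≤ 1 / 2 := by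
          rw [div_le_div_iff₀ (by positivity) (by norm_num)]; linarith
        have h3 : 0 ≤ c * (1 / 2) ^ j := by positivity
        nlinarith
      have hstep := h.step j K _ (h₁ j)
      rw [← mul_assoc, ← hc] at hstep
      rw [(hT K).2, mul_comm 4 j, pow_mul]
      refine key v (s j) _ K _ _ a b' l κ μ hρ (pow_le_one₀ (by norm_num) (by norm_num))
        (hJ₁ j ((le_max_left _ _).trans hj)) hBr hf hstep (hT K).1 ?_ (h₁ j) (h₂ j) (h₃ j)
      rw [S_sub_const, ← pow_mul, mul_comm j]
      exact he j K)
  refine ⟨C' * 2 ^ 4, fun j hj K => ?_⟩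
  obtain ⟨n, rfl⟩ := Nat.exists_eq_add_of_le' hj
  refine (hC' n K).trans (le_of_eq ?_)
  rw [mul_add, pow_add]
  norm_num
  ring
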